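/- arXiv:1306.2088 — 2 statements merged into one kernel-verified Lean document; each statement's English description precedes it below -/
import Mathlib

section
/- There exists an absolute constant c > 0 such that for every prime power q, every positive integer t, every integer k with k > 12(t+1), and every integer n with n ≥ c·k·t, there exist a positive integer λ and a simple nontrivial t-(n,k,λ) design over F_q whose number of blocks is at most q^{12(t+1)n}. -/
open Module

section Design

open Finset

theorem pow_succ_add_le_succ_pow (x n : ℕ) :
    x ^ (n + 1) + (n + 1) * x ^ n ≤ (x + 1) ^ (n + 1) := by
  induction n with
  | zero => simp
  | succ n ih =>
    have h := Nat.mul_le_mul_right (x + 1) ih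
    rw [← pow_succ] at h
    refine le_trans ?_ h
    have : 0 ≤ (n + 1) * x ^ n := Nat.zero_le _
    ring_nf
    ring_nf at this
    nlinarith

theorem two_mul_pred_pow_le (m : ℕ) (hm : 0 < m) : 2 * (m - 1) ^ m ≤ m ^ m := by
  obtain ⟨x, rfl⟩ : ∃ x, m = x + 1 := ⟨m - 1, by omega⟩
  simp only [Nat.add_sub_cancel]
  have h := pow_succ_add_le_succ_pow x x
  rw [pow_succ] at h ⊢
  nlinarith [Nat.zero_le (x ^ x)]

/-- A choice of nonzero numbers `a i` such that few characters avoid all equations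
`χ (f i) = a i`. -/
theorem exists_values_few_avoiding {G ι : Type*} [AddCommGroup G] [Fintype G] [DecidableEq ι]
    {m : ℕ} (hm : 0 < m) (hexp : ∀ x : G, m • x = 0) (s : Finset ι) (f : ι → G) :
    ∃ a : ι → ℂ, (∀ i, a i ≠ 0) ∧ ∃ X : Finset (AddChar G ℂ),
      (∀ χ : AddChar G ℂ, χ ∉ X → ∃ i ∈ s, χ (f i) = a i) ∧
      m ^ #s * #X ≤ (m - 1) ^ #s * Fintype.card G := by
  classical
  induction s using Finset.induction_on with
  | empty =>
    refine ⟨fun _ => 1, by simp, univ, by simp, ?_⟩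
    simp [AddChar.card_eq]
  | insert i s hi ih =>
    obtain ⟨a, ha, X, hX, hcard⟩ := ih
    have hroot : ∀ χ ∈ X, χ (f i) ∈ Polynomial.nthRootsFinset m (1 : ℂ) := by
      intro χ _
      rw [Polynomial.mem_nthRootsFinset hm, ← AddChar.map_nsmul_eq_pow, hexp,
        AddChar.map_zero_eq_one]
    obtain ⟨z, hz, hzc⟩ : ∃ z ∈ Polynomial.nthRootsFinset m (1 : ℂ),
        #X ≤ m * #{χ ∈ X | χ (f i) = z} := by
      by_contra! hcon
      have h1 := Finset.card_eq_sum_card_fiberwise (f := fun χ : AddChar G ℂ => χ (f i)) hroot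
      have hne : (Polynomial.nthRootsFinset m (1 : ℂ)).Nonempty :=
        ⟨1, by rw [Polynomial.mem_nthRootsFinset hm, one_pow]⟩
      have h2 : ∑ z ∈ Polynomial.nthRootsFinset m (1 : ℂ), m * #{χ ∈ X | χ (f i) = z}
          < ∑ z ∈ Polynomial.nthRootsFinset m (1 : ℂ), #X :=
        Finset.sum_lt_sum_of_nonempty hne hcon
      rw [← Finset.mul_sum, ← h1, Finset.sum_const, smul_eq_mul] at h2
      have h3 : #(Polynomial.nthRootsFinset m (1 : ℂ)) ≤ m := by
        rw [Polynomial.nthRootsFinset]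
        exact (Multiset.toFinset_card_le _).trans (Polynomial.card_nthRoots m 1)
      exact absurd h2 (not_lt.2 (Nat.mul_le_mul_right _ h3))
    refine ⟨Function.update a i z, ?_, {χ ∈ X | χ (f i) ≠ z}, ?_, ?_⟩
    · intro j
      rcases eq_or_ne j i with rfl | hj
      · rw [Function.update_self]
        rintro rfl
        rw [Polynomial.mem_nthRootsFinset hm, zero_pow hm.ne'] at hz
        exact zero_ne_one hz
      · rw [Function.update_of_ne hj]; exact ha j
    · intro χ hχ
      by_cases h : χ (f i) = z
      · exact ⟨i, by simp, by simpa using h⟩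
      · obtain ⟨j, hj, hj'⟩ := hX χ (fun h' => hχ (by simp [h', h]))
        refine ⟨j, by simp [hj], ?_⟩
        rw [Function.update_of_ne (by rintro rfl; exact hi hj), hj']
    · rw [Finset.card_insert_of_notMem hi]
      have h1 := Finset.card_filter_add_card_filter_not (s := X) (fun χ => χ (f i) = z)
      have h2 : m * #{χ ∈ X | χ (f i) ≠ z} ≤ (m - 1) * #X := by
        obtain ⟨x, rfl⟩ : ∃ x, m = x + 1 := ⟨m - 1, by omega⟩
        simp only [Nat.add_sub_cancel]
        simp only [ne_eq]
        nlinarith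
      calc m ^ (#s + 1) * #{χ ∈ X | χ (f i) ≠ z}
          = m ^ #s * (m * #{χ ∈ X | χ (f i) ≠ z}) := by ring
        _ ≤ m ^ #s * ((m - 1) * #X) := Nat.mul_le_mul_left _ h2
        _ = (m - 1) * (m ^ #s * #X) := by ring
        _ ≤ (m - 1) * ((m - 1) ^ #s * Fintype.card G) := Nat.mul_le_mul_left _ hcard
        _ = _ := by ring

theorem addChar_map_sum {G ι : Type*} [AddCommGroup G] (χ : AddChar G ℂ) (u : Finset ι)
    (f : ι → G) : χ (∑ i ∈ u, f i) = ∏ i ∈ u, χ (f i) := by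
  classical
  induction u using Finset.induction_on with
  | empty => simp
  | insert i u hi ih => rw [Finset.sum_insert hi, Finset.prod_insert hi, AddChar.map_add_eq_mul, ih]

theorem exists_nonempty_zeroSum {G ι : Type*} [AddCommGroup G] [Fintype G] [DecidableEq ι]
    {m L : ℕ} (hm : 0 < m) (hexp : ∀ x : G, m • x = 0) (hL : Fintype.card G < 2 ^ L)
    (s : Finset ι) (hs : m * L ≤ #s) (f : ι → G) :
    ∃ u ⊆ s, u.Nonempty ∧ ∑ i ∈ u, f i = 0 := by
  classical
  obtain ⟨s', hs's, hs'⟩ := Finset.exists_subset_card_eq hs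
  suffices h : ∃ u ⊆ s', u.Nonempty ∧ ∑ i ∈ u, f i = 0 by
    obtain ⟨u, hu, h⟩ := h
    exact ⟨u, hu.trans hs's, h⟩
  obtain ⟨a, ha, X, hX, hcard⟩ := exists_values_few_avoiding hm hexp s' f
  have hX0 : X = ∅ := by
    rw [← Finset.card_eq_zero]
    by_contra hne
    rw [hs'] at hcard
    have h1 : 2 ^ L * (m - 1) ^ (m * L) ≤ m ^ (m * L) := by
      rw [pow_mul, pow_mul, ← mul_pow]
      exact Nat.pow_le_pow_left (two_mul_pred_pow_le m hm) L
    have h2 : m ^ (m * L) ≤ (m - 1) ^ (m * L) * Fintype.card G :=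
      (Nat.le_mul_of_pos_right _ (Nat.pos_of_ne_zero hne)).trans hcard
    have h3 : 0 < m ^ (m * L) := by positivity
    rcases Nat.eq_zero_or_pos ((m - 1) ^ (m * L)) with h0 | h0
    · rw [h0] at h2; omega
    · have := Nat.mul_lt_mul_of_pos_left hL h0
      linarith [mul_comm (2 ^ L) ((m - 1) ^ (m * L))]
  by_contra! hcon
  have hzero : ∑ χ : AddChar G ℂ, ∏ i ∈ s', (a i - χ (f i)) = 0 := by
    refine Finset.sum_eq_zero fun χ _ => ?_
    obtain ⟨i, hi, h⟩ := hX χ (by simp [hX0])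
    exact Finset.prod_eq_zero hi (by rw [h, sub_self])
  have hexpand : ∀ χ : AddChar G ℂ, ∏ i ∈ s', (a i - χ (f i))
      = ∑ u ∈ s'.powerset, ((-1) ^ #u * ∏ i ∈ s' \ u, a i) * χ (∑ i ∈ u, f i) := by
    intro χ
    simp only [sub_eq_neg_add]
    rw [Finset.prod_add]
    refine Finset.sum_congr rfl fun u _ => ?_
    rw [Finset.prod_neg, addChar_map_sum]
    ring
  simp only [hexpand] at hzero
  rw [Finset.sum_comm] at hzero
  simp only [← Finset.mul_sum, AddChar.sum_apply_eq_ite] at hzero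
  rw [Finset.sum_eq_single ∅] at hzero
  · simp [Finset.prod_eq_zero_iff, ha] at hzero
  · intro u hu hne
    rw [if_neg (hcon u (Finset.mem_powerset.1 hu) (Finset.nonempty_iff_ne_empty.2 hne)), mul_zero]
  · simp

/-- All but few terms of a family in a finite abelian group can be kept so that they sum to
zero. -/
theorem exists_zeroSum_card_sdiff_lt {G ι : Type*} [AddCommGroup G] [Fintype G] [DecidableEq ι]
    {m L : ℕ} (hm : 0 < m) (hexp : ∀ x : G, m • x = 0) (hL : Fintype.card G < 2 ^ L)
    (s : Finset ι) (f : ι → G) :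
    ∃ u ⊆ s, #(s \ u) < m * L ∧ ∑ i ∈ u, f i = 0 := by
  classical
  obtain ⟨u, hu, hmax⟩ := Finset.exists_max_image {u ∈ s.powerset | ∑ i ∈ u, f i = 0} card
    ⟨∅, by simp⟩
  simp only [mem_filter, mem_powerset] at hu hmax
  refine ⟨u, hu.1, ?_, hu.2⟩
  by_contra! hcon
  obtain ⟨w, hws, hwn, hw⟩ := exists_nonempty_zeroSum hm hexp hL (s \ u) hcon f
  have hd : Disjoint u w := Finset.disjoint_of_subset_right hws Finset.disjoint_sdiff
  have := hmax (u ∪ w) ⟨Finset.union_subset hu.1 (hws.trans Finset.sdiff_subset), by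
    rw [Finset.sum_union hd, hu.2, hw, add_zero]⟩
  rw [Finset.card_union_of_disjoint hd] at this
  have := hwn.card_pos
  omega

/-- Conditional expectations: a sequence whose partial sums of mean-zero functions stay
small and whose terms pairwise avoid a sparse relation. -/
theorem exists_seq_potential_le {G ι : Type*} [Fintype G] [Nonempty G] [Fintype ι]
    (f : G → ι → ℝ) (K : ℝ) (hmean : ∀ i, ∑ g, f g i = 0) (hK : ∀ g i, |f g i| ≤ K)
    (C : G → G → Prop) [∀ g h, Decidable (C g h)] (ε : ℝ)
    (hC : ∀ g, (#{h | C g h} : ℝ) ≤ ε * Fintype.card G) (M : ℝ) (hM : 0 ≤ M) (N : ℕ) :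
    ∃ g : ℕ → G, ∑ i, (∑ j ∈ range N, f (g j) i) ^ 2
      + M * ∑ j ∈ range N, ∑ l ∈ range j, (if C (g l) (g j) then (1 : ℝ) else 0)
      ≤ N * (Fintype.card ι * K ^ 2) + M * ε * N ^ 2 := by
  classical
  have hcard : (0 : ℝ) < Fintype.card G := by exact_mod_cast Fintype.card_pos
  have hε : 0 ≤ ε := by
    have := (Nat.cast_nonneg _).trans (hC (Classical.arbitrary G))
    exact nonneg_of_mul_nonneg_left this hcard
  induction N with
  | zero => exact ⟨fun _ => Classical.arbitrary G, by simp⟩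
  | succ N ih =>
    obtain ⟨g, hg⟩ := ih
    set S : ι → ℝ := fun i => ∑ j ∈ range N, f (g j) i with hS
    obtain ⟨h, -, hh⟩ : ∃ h ∈ (univ : Finset G),
        ∑ i, (S i + f h i) ^ 2 + M * ∑ l ∈ range N, (if C (g l) h then (1 : ℝ) else 0)
          ≤ ∑ i, S i ^ 2 + (Fintype.card ι * K ^ 2) + M * (N * ε) := by
      refine Finset.exists_le_of_sum_le univ_nonempty ?_
      rw [Finset.sum_add_distrib, Finset.sum_comm, ← Finset.mul_sum, Finset.sum_comm (t := range N)]
      have h1 : ∑ i, ∑ h, (S i + f h i) ^ 2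
          ≤ Fintype.card G * (∑ i, S i ^ 2 + (Fintype.card ι * K ^ 2)) := by
        have : ∀ i, ∑ h, (S i + f h i) ^ 2 ≤ Fintype.card G * (S i ^ 2 + K ^ 2) := by
          intro i
          have e : ∀ h, (S i + f h i) ^ 2 ≤ S i ^ 2 + K ^ 2 + 2 * S i * f h i := by
            intro h
            have := sq_le_sq' (neg_le_of_abs_le (hK h i)) (le_of_abs_le (hK h i))
            nlinarith
          refine (Finset.sum_le_sum fun h _ => e h).trans ?_
          rw [Finset.sum_add_distrib, ← Finset.mul_sum, hmean]
          simp [mul_add]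
        refine (Finset.sum_le_sum fun i _ => this i).trans ?_
        rw [← Finset.mul_sum, Finset.sum_add_distrib]
        simp
      have h2 : ∑ l ∈ range N, ∑ h, (if C (g l) h then (1 : ℝ) else 0)
          ≤ N * (ε * Fintype.card G) := by
        refine (Finset.sum_le_card_nsmul _ _ (ε * Fintype.card G) fun l _ => ?_).trans ?_
        · rw [Finset.sum_boole]; exact hC _
        · simp
      have h3 := mul_le_mul_of_nonneg_left h2 hM
      simp only [Finset.sum_const, Finset.card_univ, nsmul_eq_mul]
      nlinarith
    have hne : ∀ j ∈ range N, Function.update g N h j = g j := fun j hj =>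
      Function.update_of_ne (Finset.mem_range.1 hj).ne _ _
    refine ⟨Function.update g N h, ?_⟩
    have e1 : ∀ i, ∑ j ∈ range (N + 1), f (Function.update g N h j) i = S i + f h i := by
      intro i
      rw [Finset.sum_range_succ, Function.update_self, hS]
      congr 1
      exact Finset.sum_congr rfl fun j hj => by rw [hne j hj]
    have e2 : ∑ j ∈ range (N + 1), ∑ l ∈ range j,
          (if C (Function.update g N h l) (Function.update g N h j) then (1 : ℝ) else 0)
        = ∑ j ∈ range N, ∑ l ∈ range j, (if C (g l) (g j) then (1 : ℝ) else 0)
          + ∑ l ∈ range N, (if C (g l) h then (1 : ℝ) else 0) := by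
      rw [Finset.sum_range_succ, Function.update_self]
      congr 1
      · refine Finset.sum_congr rfl fun j hj => Finset.sum_congr rfl fun l hl => ?_
        rw [hne j hj, hne l (Finset.mem_range.2
          ((Finset.mem_range.1 hl).trans (Finset.mem_range.1 hj)))]
      · exact Finset.sum_congr rfl fun l hl => by rw [hne l hl]
    simp only [e1, e2]
    push_cast
    have h0 : (0 : ℝ) ≤ N := Nat.cast_nonneg _
    have : 0 ≤ M * ε := mul_nonneg hM hε
    nlinarith

theorem exists_seq_pairwise_balanced {G ι : Type*} [Fintype G] [Nonempty G] [Fintype ι]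
    (f : G → ι → ℝ) (K : ℝ) (hmean : ∀ i, ∑ g, f g i = 0) (hK : ∀ g i, |f g i| ≤ K)
    (C : G → G → Prop) (ε : ℝ)
    (hC : ∀ g, (Nat.card {h // C g h} : ℝ) ≤ ε * Fintype.card G) (N : ℕ)
    (hN : ε * N ^ 2 ≤ 1 / 2) :
    ∃ g : ℕ → G, (∀ j < N, ∀ l < j, ¬ C (g l) (g j)) ∧
      ∀ i, (∑ j ∈ range N, f (g j) i) ^ 2 ≤ 2 * (N * (Fintype.card ι * K ^ 2)) + 1 := by
  classical
  set D : ℝ := N * (Fintype.card ι * K ^ 2) with hD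
  have hD0 : 0 ≤ D := by positivity
  obtain ⟨g, hg⟩ := exists_seq_potential_le f K hmean hK C ε
    (fun g => by simpa [Fintype.card_subtype] using hC g) (2 * D + 1) (by positivity) N
  have hsq : ∀ i, 0 ≤ (∑ j ∈ range N, f (g j) i) ^ 2 := fun i => sq_nonneg _
  have hbound : (2 * D + 1) * ε * N ^ 2 ≤ D + 1 / 2 := by nlinarith
  have hnn : (0 : ℝ) ≤ ∑ j ∈ range N, ∑ l ∈ range j, (if C (g l) (g j) then (1 : ℝ) else 0) :=
    Finset.sum_nonneg fun j _ => Finset.sum_nonneg fun l _ => by split_ifs <;> norm_num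
  refine ⟨g, ?_, ?_⟩
  · intro j hj l hl hcon
    have h1 : (1 : ℝ) ≤ ∑ j ∈ range N, ∑ l ∈ range j, (if C (g l) (g j) then (1 : ℝ) else 0) := by
      refine le_trans ?_ (Finset.single_le_sum (f := fun j =>
        ∑ l ∈ range j, (if C (g l) (g j) then (1 : ℝ) else 0))
        (fun j _ => Finset.sum_nonneg fun l _ => by split_ifs <;> norm_num)
        (Finset.mem_range.2 hj))
      refine le_trans ?_ (Finset.single_le_sum (f := fun l =>
        (if C (g l) (g j) then (1 : ℝ) else 0))
        (fun l _ => by split_ifs <;> norm_num) (Finset.mem_range.2 hl))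
      simp [hcon]
    have h2 : 0 ≤ ∑ i, (∑ j ∈ range N, f (g j) i) ^ 2 := Finset.sum_nonneg fun i _ => hsq i
    nlinarith
  · intro i
    have h1 := Finset.single_le_sum (f := fun i => (∑ j ∈ range N, f (g j) i) ^ 2)
      (fun i _ => hsq i) (Finset.mem_univ i)
    have h2 : 0 ≤ (2 * D + 1) * ∑ j ∈ range N, ∑ l ∈ range j,
        (if C (g l) (g j) then (1 : ℝ) else 0) := by positivity
    linarith

section Incidence

variable {A B G : Type*}

open Classical in
/-- The indicator function of an incidence relation. -/
noncomputable def incidenceInd (I : A → B → Prop) (b : B) (a : A) : ℤ := if I a b then 1 else 0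

/-- The number of blocks in `S` incident with a point. -/
noncomputable def incidenceDeg (I : A → B → Prop) (S : Finset B) (a : A) : ℤ :=
  ∑ b ∈ S, incidenceInd I b a

theorem incidenceDeg_nonneg (I : A → B → Prop) (S : Finset B) (a : A) :
    0 ≤ incidenceDeg I S a :=
  Finset.sum_nonneg fun b _ => by unfold incidenceInd; split_ifs <;> norm_num

theorem incidenceDeg_le_card (I : A → B → Prop) (S : Finset B) (a : A) :
    incidenceDeg I S a ≤ #S := by
  refine (Finset.sum_le_card_nsmul _ _ 1 fun b _ => ?_).trans (by simp)
  unfold incidenceInd; split_ifs <;> norm_num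

theorem incidenceInd_smul [Group G] [MulAction G A] [MulAction G B] {I : A → B → Prop}
    (hI : ∀ (g : G) a b, I (g • a) (g • b) ↔ I a b) (g : G) (b : B) (a : A) :
    incidenceInd I (g • b) a = incidenceInd I b (g⁻¹ • a) := by
  unfold incidenceInd
  congr 1
  rw [← hI g (g⁻¹ • a) b, smul_inv_smul]

theorem incidenceDeg_image_smul [Group G] [MulAction G A] [MulAction G B] [DecidableEq B]
    {I : A → B → Prop} (hI : ∀ (g : G) a b, I (g • a) (g • b) ↔ I a b) (g : G)
    (S : Finset B) (a : A) :
    incidenceDeg I (S.image (g • ·)) a = incidenceDeg I S (g⁻¹ • a) := by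
  unfold incidenceDeg
  rw [Finset.sum_image fun x _ y _ h => MulAction.injective g h]
  exact Finset.sum_congr rfl fun b _ => incidenceInd_smul hI g b a

theorem sum_inv_smul_eq [Group G] [Fintype G] [MulAction G A] [MulAction.IsPretransitive G A]
    (w : A → ℝ) (a a' : A) : ∑ g : G, w (g⁻¹ • a) = ∑ g : G, w (g⁻¹ • a') := by
  obtain ⟨h, rfl⟩ := MulAction.exists_smul_eq G a a'
  refine Fintype.sum_equiv (Equiv.mulLeft h) _ _ fun g => ?_
  simp [mul_smul]

theorem card_mul_sum_inv_smul [Group G] [Fintype G] [Fintype A] [MulAction G A]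
    [MulAction.IsPretransitive G A] (w : A → ℝ) (a : A) :
    Fintype.card A * ∑ g : G, w (g⁻¹ • a) = Fintype.card G * ∑ x, w x := by
  have h : ∑ x : A, ∑ g : G, w (g⁻¹ • x) = Fintype.card A * ∑ g : G, w (g⁻¹ • a) := by
    rw [Finset.sum_congr rfl fun x _ => sum_inv_smul_eq w x a]
    simp
  rw [← h, Finset.sum_comm, Finset.sum_congr rfl fun g _ =>
    Fintype.sum_equiv (MulAction.toPerm (g⁻¹ : G)) (fun x => w (g⁻¹ • x)) w fun x => rfl]
  simp

theorem card_mul_card_smul_eq [Group G] [Fintype G] [Fintype A] [MulAction G A]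
    [MulAction.IsPretransitive G A] (x y : A) [DecidablePred fun g : G => g • x = y] :
    Fintype.card A * #{g : G | g • x = y} = Fintype.card G := by
  classical
  have h := card_mul_sum_inv_smul (G := G) (fun z => if z = x then (1 : ℝ) else 0) y
  have e : ∀ g : G, g⁻¹ • y = x ↔ g • x = y := fun g => by
    rw [inv_smul_eq_iff, eq_comm]
  have h1 : ∑ z : A, (if z = x then (1 : ℝ) else 0) = 1 := by simp
  have h2 : ∑ g : G, (if g⁻¹ • y = x then (1 : ℝ) else 0) = #{g : G | g • x = y} := by
    rw [Finset.sum_boole, Finset.filter_congr fun g _ => e g]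
  rw [h1, h2, mul_one] at h
  exact_mod_cast h

theorem card_collide_le [Group G] [Fintype G] [Fintype B] [MulAction G B]
    [MulAction.IsPretransitive G B] (T : Finset B) (g : G) :
    Nat.card {h : G // ∃ b ∈ T, ∃ b' ∈ T, g • b = h • b'} * Fintype.card B
      ≤ #T ^ 2 * Fintype.card G := by
  classical
  rw [Nat.card_eq_fintype_card, Fintype.card_subtype]
  have hsub : ({h : G | ∃ b ∈ T, ∃ b' ∈ T, g • b = h • b'} : Finset G)
      ⊆ T.biUnion fun b => T.biUnion fun b' => {h : G | h • b' = g • b} := by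
    intro h
    simp only [mem_filter, mem_univ, true_and, mem_biUnion]
    rintro ⟨b, hb, b', hb', e⟩
    exact ⟨b, hb, b', hb', e.symm⟩
  calc _ ≤ (∑ b ∈ T, ∑ b' ∈ T, #{h : G | h • b' = g • b}) * Fintype.card B :=
        Nat.mul_le_mul_right _ ((Finset.card_le_card hsub).trans
          (Finset.card_biUnion_le.trans (Finset.sum_le_sum fun b _ => Finset.card_biUnion_le)))
    _ = _ := by
        simp only [Finset.sum_mul]
        rw [Finset.sum_congr rfl fun b _ => Finset.sum_congr rfl fun b' _ => by
          rw [mul_comm, card_mul_card_smul_eq]]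
        simp
        ring

end Incidence

section Incidence

variable {A B G : Type*}

/-- Random translates of the sets `Q` which can be switched to `P`, adding `m` to the degree of
one point, can be switched to form a design. -/
theorem exists_design_of_switch [Fintype A] [Fintype B] [Group G] [Fintype G] [MulAction G A]
    [MulAction G B] [MulAction.IsPretransitive G A] [MulAction.IsPretransitive G B]
    [DecidableEq A]
    {I : A → B → Prop} (hI : ∀ (g : G) a b, I (g • a) (g • b) ↔ I a b)
    (P Q : Finset B) (u : A) (m : ℕ) (hm : 0 < m)
    (hPQ : ∀ a, incidenceDeg I P a = incidenceDeg I Q a + if a = u then (m : ℤ) else 0)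
    (Λ : ℕ) (hΛ : 12 ≤ Λ) (hcard : #P + #Q ≤ Λ)
    (hB : 2 * Fintype.card A ^ 6 * Λ ^ 10 ≤ Fintype.card B) :
    ∃ lam : ℕ, 0 < lam ∧ ∃ S : Finset B, #S ≤ Fintype.card A ^ 3 * Λ ^ 5 ∧
      ∀ a, incidenceDeg I S a = lam := by
  classical
  have hP : #P ≤ Λ := by omega
  have hQ : #Q ≤ Λ := by omega
  have hA0 : 0 < Fintype.card A := Fintype.card_pos_iff.2 ⟨u⟩
  have hA1 : (1 : ℝ) ≤ Fintype.card A := by exact_mod_cast hA0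
  have hB0 : 0 < Fintype.card B := lt_of_lt_of_le (by positivity) hB
  have hG0 : (0 : ℝ) < Fintype.card G := by exact_mod_cast Fintype.card_pos
  have hΛR : (12 : ℝ) ≤ Λ := by exact_mod_cast hΛ
  have hmΛ : m ≤ Λ := by
    have h := hPQ u
    rw [if_pos rfl] at h
    have h1 := incidenceDeg_nonneg I Q u
    have h2 := incidenceDeg_le_card I P u
    have : (m : ℤ) ≤ Λ := by linarith [(Nat.cast_le (α := ℤ)).2 hP]
    exact_mod_cast this
  set N : ℕ := Fintype.card A ^ 3 * Λ ^ 4 with hN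
  set X : G → A → ℤ := fun g a => incidenceDeg I Q (g⁻¹ • a) with hX
  set Y : G → A → ℤ := fun g a => if g • u = a then 1 else 0 with hY
  have hXb : ∀ g a, 0 ≤ X g a ∧ X g a ≤ Λ := fun g a =>
    ⟨incidenceDeg_nonneg _ _ _, (incidenceDeg_le_card _ _ _).trans (by exact_mod_cast hQ)⟩
  have hYb : ∀ g a, 0 ≤ Y g a ∧ Y g a ≤ 1 := fun g a => by
    simp only [hY]; split_ifs <;> norm_num
  set μ : ℝ := (∑ g : G, (X g u : ℝ)) / Fintype.card G with hμ
  have hXs : ∀ a, ∑ g : G, (X g a : ℝ) = Fintype.card G * μ := by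
    intro a
    rw [hμ, mul_div_cancel₀ _ hG0.ne']
    exact sum_inv_smul_eq (fun a => ((incidenceDeg I Q a : ℤ) : ℝ)) a u
  have hYs : ∀ a, ∑ g : G, (Y g a : ℝ) = Fintype.card G * (1 / Fintype.card A) := by
    intro a
    have h := card_mul_card_smul_eq (G := G) u a
    have h' : (Fintype.card A : ℝ) * #{g : G | g • u = a} = Fintype.card G := by exact_mod_cast h
    rw [← h']
    simp only [hY, Int.cast_ite, Int.cast_one, Int.cast_zero, Finset.sum_boole]
    rw [mul_one_div, mul_div_cancel_left₀ _ (by linarith)]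
  have hμb : 0 ≤ μ ∧ μ ≤ Λ := by
    constructor
    · exact div_nonneg (Finset.sum_nonneg fun g _ => by exact_mod_cast (hXb g u).1) hG0.le
    · rw [hμ, div_le_iff₀ hG0]
      refine (Finset.sum_le_card_nsmul _ _ (Λ : ℝ) fun g _ => by exact_mod_cast (hXb g u).2).trans ?_
      simp [mul_comm]
  have hνb : (0 : ℝ) ≤ 1 / Fintype.card A ∧ (1 : ℝ) / Fintype.card A ≤ 1 :=
    ⟨by positivity, by rw [div_le_one (by linarith)]; exact hA1⟩
  let f : G → A ⊕ A → ℝ := fun g => Sum.elim (fun a => (X g a : ℝ) - μ)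
    (fun a => (Y g a : ℝ) - 1 / Fintype.card A)
  obtain ⟨g, hgC, hg⟩ := exists_seq_pairwise_balanced f (Λ : ℝ)
    (by
      rintro (a | a)
      · simp [f, Finset.sum_sub_distrib, hXs]
      · have := hYs a
        simp only [f, Sum.elim_inr, Finset.sum_sub_distrib, this]
        simp)
    (by
      rintro g (a | a)
      · have h1 : (0 : ℝ) ≤ X g a := by exact_mod_cast (hXb g a).1
        have h2 : (X g a : ℝ) ≤ Λ := by exact_mod_cast (hXb g a).2
        simp only [f, Sum.elim_inl]
        exact abs_le.2 ⟨by linarith [hμb.2], by linarith [hμb.1]⟩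
      · have h1 : (0 : ℝ) ≤ Y g a := by exact_mod_cast (hYb g a).1
        have h2 : (Y g a : ℝ) ≤ 1 := by exact_mod_cast (hYb g a).2
        simp only [f, Sum.elim_inr]
        exact abs_le.2 ⟨by linarith [hνb.2], by linarith [hνb.1]⟩)
    (fun g h => ∃ b ∈ P ∪ Q, ∃ b' ∈ P ∪ Q, g • b = h • b')
    ((Λ : ℝ) ^ 2 / Fintype.card B)
    (by
      intro g
      have h := (card_collide_le (P ∪ Q) g).trans (Nat.mul_le_mul_right _
        (Nat.pow_le_pow_left ((Finset.card_union_le P Q).trans hcard) 2))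
      have h' : (Nat.card {h : G // ∃ b ∈ P ∪ Q, ∃ b' ∈ P ∪ Q, g • b = h • b'} : ℝ)
          * Fintype.card B ≤ (Λ : ℝ) ^ 2 * Fintype.card G := by exact_mod_cast h
      have hB0' : (0 : ℝ) < Fintype.card B := by exact_mod_cast hB0
      rw [div_mul_eq_mul_div, le_div_iff₀ hB0']
      exact h')
    N
    (by
      have hB0' : (0 : ℝ) < Fintype.card B := by exact_mod_cast hB0
      have h' : 2 * (Fintype.card A : ℝ) ^ 6 * Λ ^ 10 ≤ Fintype.card B := by exact_mod_cast hB
      rw [div_mul_eq_mul_div, div_le_iff₀ hB0', hN]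
      push_cast
      nlinarith)
  set α : ℝ := ((Fintype.card A : ℕ) : ℝ) with hα
  have hα0 : 0 ≤ α := by linarith
  have hΛ0 : (0 : ℝ) ≤ Λ := by linarith
  have hNR : (N : ℝ) = α ^ 3 * Λ ^ 4 := by rw [hN]; push_cast; rfl
  set Δ : ℝ := 3 * α ^ 2 * Λ ^ 3 with hΔ
  have hΔ0 : 0 ≤ Δ := by positivity
  have hdev : ∀ i, |∑ j ∈ range N, f (g j) i| ≤ Δ := by
    intro i
    refine abs_le_of_sq_le_sq ((hg i).trans ?_) hΔ0
    have h1 : (1 : ℝ) ≤ α ^ 4 * Λ ^ 6 :=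
      one_le_mul_of_one_le_of_one_le (one_le_pow₀ hA1) (one_le_pow₀ (by linarith))
    rw [hNR, hΔ]
    simp only [Fintype.card_sum, Nat.cast_add, ← hα]
    nlinarith
  have hXdev : ∀ a, |∑ j ∈ range N, (X (g j) a : ℝ) - N * μ| ≤ Δ := by
    intro a
    have h := hdev (Sum.inl a)
    simpa [f, Finset.sum_sub_distrib] using h
  have hYdev : ∀ a, |∑ j ∈ range N, (Y (g j) a : ℝ) - N / α| ≤ Δ := by
    intro a
    have h := hdev (Sum.inr a)
    simpa [f, Finset.sum_sub_distrib, div_eq_mul_inv] using h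
  have : NeZero m := ⟨hm.ne'⟩
  obtain ⟨J, hJ, hJc, hJ0⟩ := exists_zeroSum_card_sdiff_lt (G := A → ZMod m) (m := m)
    (L := m * Fintype.card A) hm
    (fun x => by ext a; simp)
    (by
      rw [Fintype.card_fun, ZMod.card, pow_mul]
      exact Nat.pow_lt_pow_left Nat.lt_two_pow_self hA0.ne')
    (range N) (fun j a => ((X (g j) a : ℤ) : ZMod m))
  have hJcR : (#(range N \ J) : ℝ) ≤ α * Λ ^ 2 := by
    have h1 : (#(range N \ J) : ℝ) ≤ m * (m * α) := by rw [hα]; exact_mod_cast hJc.le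
    have h2 : (m : ℝ) ≤ Λ := by exact_mod_cast hmΛ
    have h3 : (m : ℝ) * m ≤ Λ * Λ := mul_le_mul h2 h2 (Nat.cast_nonneg _) hΛ0
    nlinarith
  set v : A → ℤ := fun a => ∑ j ∈ J, X (g j) a with hv
  have hvm : ∀ a, (m : ℤ) ∣ v a := by
    intro a
    rw [← ZMod.intCast_zmod_eq_zero_iff_dvd]
    have := congrFun hJ0 a
    simpa [hv] using this
  have hsplit : ∀ Z : ℕ → ℝ, ∑ j ∈ range N, Z j = ∑ j ∈ J, Z j + ∑ j ∈ range N \ J, Z j :=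
    fun Z => by rw [add_comm, Finset.sum_sdiff hJ]
  have hv1 : ∀ a, (v a : ℝ) ≤ N * μ + Δ := by
    intro a
    have h1 := hsplit fun j => (X (g j) a : ℝ)
    have h2 : (0 : ℝ) ≤ ∑ j ∈ range N \ J, (X (g j) a : ℝ) :=
      Finset.sum_nonneg fun j _ => by exact_mod_cast (hXb (g j) a).1
    have h3 := (abs_le.1 (hXdev a)).2
    simp only [hv]; push_cast; linarith
  have hv2 : ∀ a, N * μ - Δ - α * Λ ^ 3 ≤ (v a : ℝ) := by
    intro a
    have h1 := hsplit fun j => (X (g j) a : ℝ)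
    have h2 : ∑ j ∈ range N \ J, (X (g j) a : ℝ) ≤ α * Λ ^ 2 * Λ := by
      refine (Finset.sum_le_card_nsmul _ _ (Λ : ℝ) fun j _ => by
        exact_mod_cast (hXb (g j) a).2).trans ?_
      rw [nsmul_eq_mul]
      exact mul_le_mul_of_nonneg_right hJcR hΛ0
    have h3 := (abs_le.1 (hXdev a)).1
    simp only [hv]; push_cast; nlinarith
  have hr : ∀ a, α ^ 2 * Λ ^ 4 - Δ - α * Λ ^ 2 ≤ (#{j ∈ J | g j • u = a} : ℝ) := by
    intro a
    have h1 := hsplit fun j => (Y (g j) a : ℝ)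
    have h2 : ∑ j ∈ range N \ J, (Y (g j) a : ℝ) ≤ α * Λ ^ 2 := by
      refine (Finset.sum_le_card_nsmul _ _ (1 : ℝ) fun j _ => by
        exact_mod_cast (hYb (g j) a).2).trans ?_
      simpa using hJcR
    have h3 := (abs_le.1 (hYdev a)).1
    have h4 : ∑ j ∈ J, (Y (g j) a : ℝ) = (#{j ∈ J | g j • u = a} : ℝ) := by
      simp only [hY, Int.cast_ite, Int.cast_one, Int.cast_zero, Finset.sum_boole]
    have h5 : (N : ℝ) / α = α ^ 2 * Λ ^ 4 := by
      rw [hNR]; field_simp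
    linarith
  set E : ℝ := N * μ + Δ with hE
  have hE0 : 0 ≤ E := by have := hμb.1; positivity
  set lam : ℕ := m * (⌊E / m⌋₊ + 1) with hlam
  have hmR : (0 : ℝ) < m := by exact_mod_cast hm
  have hlam1 : E < lam := by
    have := Nat.lt_floor_add_one (E / m)
    rw [div_lt_iff₀ hmR] at this
    rw [hlam]; push_cast; linarith
  have hlam2 : (lam : ℝ) ≤ E + m := by
    have := Nat.floor_le (div_nonneg hE0 hmR.le)
    rw [le_div_iff₀ hmR] at this
    rw [hlam]; push_cast; linarith
  have hx : ∀ a, ∃ s ⊆ ({j ∈ J | g j • u = a} : Finset ℕ), (m : ℤ) * #s = lam - v a := by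
    intro a
    have hd : (m : ℤ) ∣ lam - v a := by
      refine dvd_sub ?_ (hvm a)
      rw [hlam]; push_cast; exact dvd_mul_right _ _
    obtain ⟨x, hx⟩ := hd
    have hpos : (0 : ℤ) < m * x := by
      rw [← hx]
      have : (v a : ℝ) < lam := (hv1 a).trans_lt hlam1
      have : v a < lam := by exact_mod_cast this
      omega
    have hx0 : 0 < x := pos_of_mul_pos_right hpos (by positivity)
    have hxle : (x : ℝ) ≤ (#{j ∈ J | g j • u = a} : ℝ) := by
      refine le_trans ?_ (hr a)
      have h1 : (x : ℝ) ≤ lam - v a := by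
        have : x ≤ lam - v a := by
          rw [hx]; nlinarith [(Nat.cast_le (α := ℤ)).2 hm]
        exact_mod_cast this
      have h2 := hv2 a
      have h3 : (m : ℝ) ≤ Λ := by exact_mod_cast hmΛ
      have h4 : α ^ 2 * Λ ^ 3 * 12 ≤ α ^ 2 * Λ ^ 3 * Λ :=
        mul_le_mul_of_nonneg_left hΛR (by positivity)
      have hL1 : (1 : ℝ) ≤ Λ := by linarith
      have h5 : α * Λ ^ 3 ≤ α ^ 2 * Λ ^ 3 :=
        mul_le_mul_of_nonneg_right (le_self_pow₀ hA1 two_ne_zero) (by positivity)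
      have h6 : α * Λ ^ 2 ≤ α ^ 2 * Λ ^ 3 :=
        mul_le_mul (le_self_pow₀ hA1 two_ne_zero) (pow_le_pow_right₀ hL1 (by norm_num))
          (by positivity) (by positivity)
      have h7 : (Λ : ℝ) ≤ α ^ 2 * Λ ^ 3 :=
        (le_self_pow₀ hL1 three_ne_zero).trans
          (le_mul_of_one_le_left (by positivity) (one_le_pow₀ hA1))
      nlinarith
    have hxle' : x.toNat ≤ #{j ∈ J | g j • u = a} := by
      have : x ≤ (#{j ∈ J | g j • u = a} : ℕ) := by exact_mod_cast hxle
      omega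
    obtain ⟨s, hs, hsc⟩ := Finset.exists_subset_card_eq hxle'
    refine ⟨s, hs, ?_⟩
    rw [hx, hsc, Int.toNat_of_nonneg hx0.le]
  choose s hs hsc using hx
  set R : ℕ → Finset B := fun j => if j ∈ s (g j • u) then P else Q with hR
  have hRsub : ∀ j, R j ⊆ P ∪ Q := by
    intro j; simp only [hR]; split_ifs
    · exact Finset.subset_union_left
    · exact Finset.subset_union_right
  have hRcard : ∀ j, #(R j) ≤ Λ := by
    intro j; simp only [hR]; split_ifs <;> assumption
  have hdisj : (J : Set ℕ).PairwiseDisjoint fun j => (R j).image (g j • ·) := by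
    have key : ∀ j ∈ J, ∀ l < j, Disjoint ((R l).image (g l • ·)) ((R j).image (g j • ·)) := by
      intro j hj l hl
      rw [Finset.disjoint_left]
      intro b hb hb'
      obtain ⟨c, hc, rfl⟩ := Finset.mem_image.1 hb
      obtain ⟨d, hd, he⟩ := Finset.mem_image.1 hb'
      exact hgC j (Finset.mem_range.1 (hJ hj)) l hl ⟨c, hRsub l hc, d, hRsub j hd, he.symm⟩
    intro j hj l hl hne
    rcases lt_or_gt_of_ne hne with h | h
    · exact key l hl j h
    · exact (key j hj l h).symm
  refine ⟨lam, by positivity, J.biUnion fun j => (R j).image (g j • ·), ?_, ?_⟩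
  · calc _ ≤ #J * Λ := Finset.card_biUnion_le_card_mul _ _ _ fun j _ =>
          Finset.card_image_le.trans (hRcard j)
      _ ≤ N * Λ := Nat.mul_le_mul_right _ (by simpa using Finset.card_le_card hJ)
      _ = _ := by rw [hN]; ring
  · intro a
    have h1 : incidenceDeg I (J.biUnion fun j => (R j).image (g j • ·)) a
        = ∑ j ∈ J, incidenceDeg I ((R j).image (g j • ·)) a := by
      unfold incidenceDeg
      rw [Finset.sum_biUnion hdisj]
    have h2 : ∀ j ∈ J, incidenceDeg I ((R j).image (g j • ·)) a
        = X (g j) a + if j ∈ s a then (m : ℤ) else 0 := by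
      intro j hj
      rw [incidenceDeg_image_smul hI]
      have e : (g j)⁻¹ • a = u ↔ g j • u = a := by rw [inv_smul_eq_iff, eq_comm]
      by_cases hja : j ∈ s a
      · have hu : g j • u = a := (Finset.mem_filter.1 (hs a hja)).2
        have : R j = P := by simp only [hR]; rw [hu, if_pos hja]
        rw [this, hPQ, if_pos (e.2 hu), if_pos hja]
      · rw [if_neg hja, add_zero]
        simp only [hR]
        split_ifs with h
        · have hu : ¬ (g j)⁻¹ • a = u := by
            intro h'
            rw [e.1 h'] at h
            exact hja h
          rw [hPQ, if_neg hu, add_zero]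
        · rfl
    rw [h1, Finset.sum_congr rfl h2, Finset.sum_add_distrib, ← Finset.sum_filter,
      Finset.sum_const, Finset.filter_mem_eq_inter,
      Finset.inter_eq_right.2 ((hs a).trans (Finset.filter_subset _ _)), nsmul_eq_mul,
      mul_comm, hsc a]
    simp only [hv]
    ring

end Incidence

section Incidence

variable {A B G : Type*}

theorem incidenceDeg_union [DecidableEq B] {I : A → B → Prop} {S T : Finset B}
    (h : Disjoint S T) (a : A) :
    incidenceDeg I (S ∪ T) a = incidenceDeg I S a + incidenceDeg I T a :=
  Finset.sum_union h

/-- The blocks of `N₁ \ {b₀}` and `N₂` can be moved away from a small set while `b₀` is moved to a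
prescribed block. -/
theorem exists_smul_eq_forall_notMem [DecidableEq B] [Group G] [Fintype G] [MulAction G B]
    [MulAction.IsPretransitive G B] (N : Finset B) (b₀ b : B) (κ : ℕ)
    (hκ : ∀ b' ∈ N, b' ≠ b₀ → ∀ b c : B,
      κ * Nat.card {g : G // g • b₀ = b ∧ g • b' = c} ≤ Nat.card {g : G // g • b₀ = b})
    (F : Finset B) (hF : #N * #F < κ) :
    ∃ g : G, g • b₀ = b ∧ ∀ b' ∈ N.erase b₀, g • b' ∉ F := by
  classical
  by_contra! hcon
  have hsub : ({g : G | g • b₀ = b} : Finset G) ⊆ (N.erase b₀).biUnion fun b' =>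
      F.biUnion fun c => {g : G | g • b₀ = b ∧ g • b' = c} := by
    intro g hg
    have hg' : g • b₀ = b := by simpa using hg
    obtain ⟨b', hb', h⟩ := hcon g hg'
    simp only [mem_biUnion, mem_filter, mem_univ, true_and]
    exact ⟨b', hb', _, h, hg', rfl⟩
  have hpos : 0 < #{g : G | g • b₀ = b} := by
    obtain ⟨g, hg⟩ := MulAction.exists_smul_eq G b₀ b
    exact Finset.card_pos.2 ⟨g, by simpa using hg⟩
  simp only [Nat.card_eq_fintype_card, Fintype.card_subtype] at hκ
  have h1 : κ * #{g : G | g • b₀ = b} ≤ #N * #F * #{g : G | g • b₀ = b} := by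
    calc κ * #{g : G | g • b₀ = b}
        ≤ κ * ∑ b' ∈ N.erase b₀, ∑ c ∈ F, #{g : G | g • b₀ = b ∧ g • b' = c} :=
          Nat.mul_le_mul_left _ ((Finset.card_le_card hsub).trans
            (Finset.card_biUnion_le.trans (Finset.sum_le_sum fun b _ => Finset.card_biUnion_le)))
      _ = ∑ b' ∈ N.erase b₀, ∑ c ∈ F, κ * #{g : G | g • b₀ = b ∧ g • b' = c} := by
          simp only [Finset.mul_sum]
      _ ≤ ∑ b' ∈ N.erase b₀, ∑ c ∈ F, #{g : G | g • b₀ = b} :=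
          Finset.sum_le_sum fun b' hb' => Finset.sum_le_sum fun c _ =>
            hκ b' (Finset.mem_of_mem_erase hb') (Finset.ne_of_mem_erase hb') b c
      _ = #(N.erase b₀) * #F * #{g : G | g • b₀ = b} := by simp; ring
      _ ≤ _ := Nat.mul_le_mul_right _ (Nat.mul_le_mul_right _ (Finset.card_erase_le))
  exact absurd (Nat.mul_lt_mul_of_pos_right hF hpos) (not_lt.2 h1)

/-- A signed combination of blocks is equivalent to one with coefficients `±1`, as soon as
there is a spread-out trade with coefficients `±1`. -/
theorem exists_simple_signed_sum [DecidableEq B] [Fintype B] [Group G] [Fintype G]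
    [MulAction G A] [MulAction G B] [MulAction.IsPretransitive G B] {I : A → B → Prop}
    (hI : ∀ (g : G) a b, I (g • a) (g • b) ↔ I a b)
    (N₁ N₂ : Finset B) (hd : Disjoint N₁ N₂)
    (hN : ∀ a, incidenceDeg I N₁ a = incidenceDeg I N₂ a) (b₀ : B) (hb₀ : b₀ ∈ N₁) (κ : ℕ)
    (hκ : ∀ b' ∈ N₁ ∪ N₂, b' ≠ b₀ → ∀ b c : B,
      κ * Nat.card {g : G // g • b₀ = b ∧ g • b' = c} ≤ Nat.card {g : G // g • b₀ = b})
    (L : ℕ) (hL : #(N₁ ∪ N₂) ^ 2 * L < κ) :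
    ∀ l ≤ L, ∀ γ : B → ℤ, ∑ b, |γ b| ≤ l → ∃ P Q : Finset B, Disjoint P Q ∧
      #P + #Q ≤ l * #(N₁ ∪ N₂) ∧
      ∀ a, incidenceDeg I P a = incidenceDeg I Q a + ∑ b, γ b * incidenceInd I b a := by
  intro l
  induction l with
  | zero =>
    intro _ γ hγ
    refine ⟨∅, ∅, by simp, by simp, fun a => ?_⟩
    have h0 : ∀ b, γ b = 0 := by
      intro b
      have := Finset.single_le_sum (f := fun b => |γ b|) (fun b _ => abs_nonneg _)
        (Finset.mem_univ b)
      have h2 := abs_nonneg (γ b)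
      push_cast at hγ
      exact abs_eq_zero.1 (le_antisymm (this.trans hγ) h2)
    simp [incidenceDeg, h0]
  | succ l ih =>
    intro hl γ hγ
    by_cases hz : ∀ b, γ b = 0
    · exact ⟨∅, ∅, by simp, by simp, fun a => by simp [incidenceDeg, hz]⟩
    push Not at hz
    obtain ⟨b, hb⟩ := hz
    set σ : ℤ := (γ b).sign with hσ
    have hσb : |γ b - σ| = |γ b| - 1 := by
      rcases lt_or_gt_of_ne hb with h | h
      · rw [hσ, Int.sign_eq_neg_one_of_neg h, abs_of_neg h, abs_of_nonpos (by omega)]; ring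
      · rw [hσ, Int.sign_eq_one_of_pos h, abs_of_pos h, abs_of_nonneg (by omega)]
    obtain ⟨P, Q, hPQ, hcard, hdeg⟩ := ih (by omega) (Function.update γ b (γ b - σ)) (by
      rw [← Finset.add_sum_erase _ _ (Finset.mem_univ b)] at hγ ⊢
      rw [Function.update_self, hσb, Finset.sum_congr rfl fun c hc => by
        rw [Function.update_of_ne (Finset.ne_of_mem_erase hc)]]
      push_cast at hγ
      linarith)
    have hsum : ∀ a, ∑ c, Function.update γ b (γ b - σ) c * incidenceInd I c a
        = ∑ c, γ c * incidenceInd I c a - σ * incidenceInd I b a := by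
      intro a
      rw [← Finset.add_sum_erase _ _ (Finset.mem_univ b),
        ← Finset.add_sum_erase (a := b) _ (fun c => γ c * incidenceInd I c a) (Finset.mem_univ b),
        Function.update_self, Finset.sum_congr rfl fun c hc => by
        rw [Function.update_of_ne (Finset.ne_of_mem_erase hc)]]
      ring
    obtain ⟨g, hg, hgF⟩ := exists_smul_eq_forall_notMem (G := G) (N₁ ∪ N₂) b₀ b κ hκ (P ∪ Q) (by
      refine lt_of_le_of_lt ?_ hL
      calc #(N₁ ∪ N₂) * #(P ∪ Q) ≤ #(N₁ ∪ N₂) * (l * #(N₁ ∪ N₂)) :=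
            Nat.mul_le_mul_left _ ((Finset.card_union_le _ _).trans hcard)
        _ = #(N₁ ∪ N₂) ^ 2 * l := by ring
        _ ≤ _ := Nat.mul_le_mul_left _ (by omega))
    set M₁ := (N₁.erase b₀).image (g • ·) with hM₁
    set M₂ := N₂.image (g • ·) with hM₂
    have hb₀2 : b₀ ∉ N₂ := Finset.disjoint_left.1 hd hb₀
    have hM₁F : Disjoint M₁ (P ∪ Q) := by
      rw [Finset.disjoint_left]
      intro c hc
      obtain ⟨d, hdm, rfl⟩ := Finset.mem_image.1 hc
      exact hgF d (Finset.mem_erase.2 ⟨Finset.ne_of_mem_erase hdm,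
        Finset.mem_union_left _ (Finset.mem_of_mem_erase hdm)⟩)
    have hM₂F : Disjoint M₂ (P ∪ Q) := by
      rw [Finset.disjoint_left]
      intro c hc
      obtain ⟨d, hdm, rfl⟩ := Finset.mem_image.1 hc
      exact hgF d (Finset.mem_erase.2 ⟨fun h => hb₀2 (h ▸ hdm), Finset.mem_union_right _ hdm⟩)
    have hMM : Disjoint M₁ M₂ := by
      rw [hM₁, hM₂, Finset.disjoint_image (MulAction.injective g)]
      exact Finset.disjoint_of_subset_left (Finset.erase_subset _ _) hd
    rw [Finset.disjoint_union_right] at hM₁F hM₂F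
    have hind : ∀ a, incidenceDeg I M₂ a - incidenceDeg I M₁ a = incidenceInd I b a := by
      intro a
      rw [hM₁, hM₂, incidenceDeg_image_smul hI, incidenceDeg_image_smul hI, ← hN, ← hg,
        incidenceInd_smul hI]
      unfold incidenceDeg
      rw [← Finset.add_sum_erase _ _ hb₀]
      ring
    have hMcard : #M₁ + #M₂ ≤ #(N₁ ∪ N₂) := by
      rw [Finset.card_union_of_disjoint hd]
      exact Nat.add_le_add (Finset.card_image_le.trans Finset.card_erase_le) Finset.card_image_le
    rcases lt_or_gt_of_ne hb with h | h
    · refine ⟨P ∪ M₁, Q ∪ M₂, ?_, ?_, ?_⟩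
      · simp only [Finset.disjoint_union_left, Finset.disjoint_union_right]
        exact ⟨⟨hPQ, hM₁F.2⟩, hM₂F.1.symm, hMM⟩
      · have h1 := Finset.card_union_le P M₁
        have h2 := Finset.card_union_le Q M₂
        rw [add_mul]; omega
      · intro a
        rw [incidenceDeg_union hM₁F.1.symm, incidenceDeg_union hM₂F.2.symm, hdeg, hsum,
          ← hind, hσ, Int.sign_eq_neg_one_of_neg h]
        ring
    · refine ⟨P ∪ M₂, Q ∪ M₁, ?_, ?_, ?_⟩
      · simp only [Finset.disjoint_union_left, Finset.disjoint_union_right]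
        exact ⟨⟨hPQ, hM₂F.2⟩, hM₁F.1.symm, hMM.symm⟩
      · have h1 := Finset.card_union_le P M₂
        have h2 := Finset.card_union_le Q M₁
        rw [add_mul]; omega
      · intro a
        rw [incidenceDeg_union hM₂F.1.symm, incidenceDeg_union hM₁F.2.symm, hdeg, hsum,
          ← hind, hσ, Int.sign_eq_one_of_pos h]
        ring

end Incidence

section Transitivity

variable {F V V' : Type*} [Field F] [AddCommGroup V] [Module F V] [AddCommGroup V'] [Module F V']

theorem exists_linearEquiv_glue {U C : Submodule F V} {U' C' : Submodule F V'} (h : IsCompl U C)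
    (h' : IsCompl U' C') (e : U ≃ₗ[F] U') (f : C ≃ₗ[F] C') :
    ∃ g : V ≃ₗ[F] V', (∀ x : U, g x = e x) ∧ ∀ x : C, g x = f x := by
  refine ⟨(U.prodEquivOfIsCompl C h).symm ≪≫ₗ (e.prodCongr f) ≪≫ₗ U'.prodEquivOfIsCompl C' h',
    fun x => ?_, fun x => ?_⟩ <;> simp

theorem map_eq_of_eqOn {U : Submodule F V} {U' : Submodule F V'} (e : U ≃ₗ[F] U')
    (g : V ≃ₗ[F] V') (hg : ∀ x : U, g x = e x) {S : Submodule F V} (hS : S ≤ U)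
    {S' : Submodule F V'} (hS' : S' ≤ U')
    (he : (S.comap U.subtype).map (e : U →ₗ[F] U') = S'.comap U'.subtype) :
    S.map (g : V →ₗ[F] V') = S' := by
  have h1 : S = (S.comap U.subtype).map U.subtype := by
    rw [Submodule.map_comap_subtype, inf_eq_right.2 hS]
  have h2 : S' = (S'.comap U'.subtype).map U'.subtype := by
    rw [Submodule.map_comap_subtype, inf_eq_right.2 hS']
  rw [h2, ← he]
  conv_lhs => rw [h1]
  rw [← Submodule.map_comp, ← Submodule.map_comp]
  congr 1
  ext x
  exact hg x

theorem finrank_eq_of_isCompl [FiniteDimensional F V] [FiniteDimensional F V']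
    (hV : finrank F V = finrank F V') {U C : Submodule F V} {U' C' : Submodule F V'}
    (h : IsCompl U C) (h' : IsCompl U' C') (hU : finrank F U = finrank F U') :
    finrank F C = finrank F C' := by
  have := Submodule.finrank_add_eq_of_isCompl h
  have := Submodule.finrank_add_eq_of_isCompl h'
  omega

theorem exists_linearEquiv_map_eq [FiniteDimensional F V] [FiniteDimensional F V']
    (hV : finrank F V = finrank F V') {U : Submodule F V} {U' : Submodule F V'}
    (hU : finrank F U = finrank F U') : ∃ g : V ≃ₗ[F] V', U.map (g : V →ₗ[F] V') = U' := by
  obtain ⟨C, hC⟩ := Submodule.exists_isCompl U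
  obtain ⟨C', hC'⟩ := Submodule.exists_isCompl U'
  have e := LinearEquiv.ofFinrankEq _ _ hU
  have f := LinearEquiv.ofFinrankEq _ _ (finrank_eq_of_isCompl hV hC hC' hU)
  obtain ⟨g, hg, -⟩ := exists_linearEquiv_glue hC hC' e f
  exact ⟨g, map_eq_of_eqOn e g hg le_rfl le_rfl (by simp)⟩

theorem exists_inf_compl (T U : Submodule F V) :
    ∃ T₁, T₁ ≤ T ∧ Disjoint T₁ U ∧ Disjoint (T ⊓ U) T₁ ∧ T ⊓ U ⊔ T₁ = T := by
  obtain ⟨D, hD⟩ := Submodule.exists_isCompl (T ⊓ U)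
  refine ⟨T ⊓ D, inf_le_left, ?_, ?_, ?_⟩
  · rw [disjoint_iff, inf_right_comm]
    exact disjoint_iff.1 hD.disjoint
  · exact hD.disjoint.mono_right inf_le_right
  · rw [inf_comm T D, ← sup_inf_assoc_of_le D (inf_le_left : T ⊓ U ≤ T), hD.sup_eq_top, top_inf_eq]

theorem exists_linearEquiv_map_eq_map_eq [FiniteDimensional F V] [FiniteDimensional F V']
    (hV : finrank F V = finrank F V') {U T : Submodule F V} {U' T' : Submodule F V'}
    (hU : finrank F U = finrank F U') (hT : finrank F T = finrank F T')
    (hTU : finrank F (T ⊓ U : Submodule F V) = finrank F (T' ⊓ U' : Submodule F V')) :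
    ∃ g : V ≃ₗ[F] V', U.map (g : V →ₗ[F] V') = U' ∧ T.map (g : V →ₗ[F] V') = T' := by
  obtain ⟨T₁, hT₁, hd, hd₁, hs⟩ := exists_inf_compl T U
  obtain ⟨T₁', hT₁', hd', hd₁', hs'⟩ := exists_inf_compl T' U'
  obtain ⟨C, hTC, hC⟩ := hd.exists_isCompl
  obtain ⟨C', hTC', hC'⟩ := hd'.exists_isCompl
  have hT1 : finrank F T₁ = finrank F T₁' := by
    have h1 := Submodule.finrank_sup_add_finrank_inf_eq (T ⊓ U) T₁
    have h2 := Submodule.finrank_sup_add_finrank_inf_eq (T' ⊓ U') T₁'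
    rw [hs, hd₁.eq_bot, finrank_bot] at h1
    rw [hs', hd₁'.eq_bot, finrank_bot] at h2
    omega
  have key : ∀ {W : Submodule F V} {W' : Submodule F V'} {S : Submodule F V}
      {S' : Submodule F V'}, finrank F W = finrank F W' → S ≤ W → S' ≤ W' →
      finrank F S = finrank F S' → ∃ e : W ≃ₗ[F] W',
        (S.comap W.subtype).map (e : W →ₗ[F] W') = S'.comap W'.subtype := by
    intro W W' S S' hW hS hS' hSS
    refine exists_linearEquiv_map_eq hW ?_
    rw [(Submodule.comapSubtypeEquivOfLe hS).finrank_eq,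
      (Submodule.comapSubtypeEquivOfLe hS').finrank_eq, hSS]
  obtain ⟨e, he⟩ := key hU (inf_le_right : T ⊓ U ≤ U) (inf_le_right : T' ⊓ U' ≤ U') hTU
  obtain ⟨f, hf⟩ := key (finrank_eq_of_isCompl hV hC.symm hC'.symm hU) hTC hTC' hT1
  obtain ⟨g, hg, hg'⟩ := exists_linearEquiv_glue hC.symm hC'.symm e f
  refine ⟨g, map_eq_of_eqOn e g hg le_rfl le_rfl (by simp), ?_⟩
  rw [← hs, ← hs', Submodule.map_sup, map_eq_of_eqOn e g hg inf_le_right inf_le_right he,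
    map_eq_of_eqOn f g hg' hTC hTC' hf]

end Transitivity

section Grassmannian

variable (F V : Type*) [Field F] [AddCommGroup V] [Module F V]

/-- The `k`-dimensional subspaces of a vector space. -/
abbrev Subspaces (k : ℕ) : Type _ := {S : Submodule F V // finrank F S = k}

variable {F V}

theorem finrank_map_linearEquiv (g : V ≃ₗ[F] V) (S : Submodule F V) :
    finrank F (S.map (g : V →ₗ[F] V)) = finrank F S :=
  LinearEquiv.finrank_map_eq g S

noncomputable instance (k : ℕ) : MulAction (V ≃ₗ[F] V) (Subspaces F V k) where
  smul g S := ⟨S.1.map (g : V →ₗ[F] V), (finrank_map_linearEquiv g S.1).trans S.2⟩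
  one_smul S := Subtype.ext (Submodule.map_id S.1)
  mul_smul g h S := Subtype.ext (Submodule.map_comp (h : V →ₗ[F] V) (g : V →ₗ[F] V) S.1)

theorem coe_smul_subspaces {k : ℕ} (g : V ≃ₗ[F] V) (S : Subspaces F V k) :
    ((g • S : Subspaces F V k) : Submodule F V) = S.1.map (g : V →ₗ[F] V) := rfl

instance [FiniteDimensional F V] (k : ℕ) :
    MulAction.IsPretransitive (V ≃ₗ[F] V) (Subspaces F V k) where
  exists_smul_eq S T := by
    obtain ⟨g, hg⟩ := exists_linearEquiv_map_eq (F := F) (V := V) (V' := V) rfl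
      (S.2.trans T.2.symm)
    exact ⟨g, Subtype.ext hg⟩

theorem smul_le_smul_subspaces {t k : ℕ} (g : V ≃ₗ[F] V) (T : Subspaces F V t)
    (S : Subspaces F V k) : (g • T).1 ≤ (g • S).1 ↔ T.1 ≤ S.1 := by
  rw [coe_smul_subspaces, coe_smul_subspaces]
  exact Submodule.map_le_map_iff_of_injective g.injective _ _

end Grassmannian

section Decoding

variable {A B : Type*} [Fintype B]

/-- `h` is an integer combination, of total absolute weight at most `x`, of the incidence
indicators. -/
def IsDecodable (I : A → B → Prop) (h : A → ℤ) (x : ℤ) : Prop :=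
  ∃ γ : B → ℤ, (∀ a, ∑ b, γ b * incidenceInd I b a = h a) ∧ ∑ b, |γ b| ≤ x

variable {I : A → B → Prop}

theorem IsDecodable.mono {h : A → ℤ} {x y : ℤ} (hd : IsDecodable I h x) (hxy : x ≤ y) :
    IsDecodable I h y :=
  let ⟨γ, h1, h2⟩ := hd
  ⟨γ, h1, h2.trans hxy⟩

theorem IsDecodable.zero : IsDecodable I (fun _ => 0) 0 := ⟨fun _ => 0, by simp, by simp⟩

theorem IsDecodable.add {h h' : A → ℤ} {x x' : ℤ} (hd : IsDecodable I h x)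
    (hd' : IsDecodable I h' x') : IsDecodable I (fun a => h a + h' a) (x + x') := by
  obtain ⟨γ, h1, h2⟩ := hd
  obtain ⟨γ', h1', h2'⟩ := hd'
  refine ⟨fun b => γ b + γ' b, fun a => ?_, ?_⟩
  · simp only [add_mul, sum_add_distrib, h1, h1']
  · refine (sum_le_sum fun b _ => abs_add_le (γ b) (γ' b)).trans ?_
    rw [sum_add_distrib]
    exact add_le_add h2 h2'

theorem IsDecodable.smul {h : A → ℤ} {x y : ℤ} (c : ℤ) (hd : IsDecodable I h x) (hc : |c| ≤ y) : IsDecodable I (fun a => c * h a) (y * x) := by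
  obtain ⟨γ, h1, h2⟩ := hd
  refine ⟨fun b => c * γ b, fun a => ?_, ?_⟩
  · simp only [mul_assoc, ← mul_sum, h1]
  · simp only [abs_mul, ← mul_sum]
    exact mul_le_mul hc h2 (sum_nonneg fun _ _ => abs_nonneg _) ((abs_nonneg _).trans hc)

theorem IsDecodable.sum_range {h : ℕ → A → ℤ} {x : ℤ} :
    ∀ j : ℕ, (∀ i < j, IsDecodable I (h i) x) →
      IsDecodable I (fun a => ∑ i ∈ range j, h i a) (j * x)
  | 0, _ => by simpa using IsDecodable.zero
  | j + 1, H => by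
    simp only [sum_range_succ]
    exact ((IsDecodable.sum_range j fun i hi => H i (by omega)).add (H j (by omega))).mono
      (by push_cast; linarith)

theorem isDecodable_incidenceDeg (I : A → B → Prop) (S : Finset B) :
    IsDecodable I (incidenceDeg I S) #S := by
  classical
  refine ⟨fun b => if b ∈ S then 1 else 0, fun a => ?_, ?_⟩
  · simp [incidenceDeg]
  · rw [sum_congr rfl fun b _ => show |if b ∈ S then (1 : ℤ) else 0| = if b ∈ S then 1 else 0 by
      split_ifs <;> norm_num]
    simp

/-- A triangular system of decodable functions can be inverted, up to a common multiple. -/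
theorem exists_isDecodable_of_triangular (e g : ℕ → A → ℤ) (c : ℕ → ℕ → ℤ) (D : ℤ) (t : ℕ)
    (hg : ∀ j ≤ t, ∀ a, g j a = ∑ i ∈ range j, c i j * e i a + c j j * e j a)
    (hc : ∀ i j, |c i j| ≤ D) (hpos : ∀ j, 0 < c j j)
    (hd : ∀ j ≤ t, IsDecodable I (g j) D) :
    ∀ j ≤ t + 1, ∃ M : ℤ, 0 < M ∧ M ≤ ((t + 1) * D) ^ j ∧
      ∀ i < j, IsDecodable I (fun a => M * e i a) (((t + 1) * D) ^ j) := by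
  have hD : 1 ≤ D := by
    have h1 := hpos 0
    have h2 := (le_abs_self _).trans (hc 0 0)
    omega
  intro j
  induction j with
  | zero => exact fun _ => ⟨1, by norm_num, by norm_num, by simp⟩
  | succ j ih =>
    intro hj
    obtain ⟨M, hM, hMx, hM'⟩ := ih (by omega)
    set x : ℤ := ((t + 1) * D) ^ j with hx
    have hx0 : 0 < x := hM.trans_le hMx
    have hjt : (j : ℤ) ≤ t := by exact_mod_cast (by omega : j ≤ t)
    have hDx : D * x ≤ ((t + 1) * D) ^ (j + 1) := by
      rw [pow_succ, ← hx]
      nlinarith [mul_pos (by omega : 0 < D) hx0]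
    refine ⟨c j j * M, mul_pos (hpos j) hM, le_trans ?_ hDx, fun i hi => ?_⟩
    · exact mul_le_mul ((le_abs_self _).trans (hc j j)) hMx hM.le (by omega)
    · rcases Nat.lt_succ_iff_lt_or_eq.1 hi with hi | rfl
      · simpa only [mul_assoc] using ((hM' i hi).smul (c j j) (hc j j)).mono hDx
      · have h1 := (hd i (by omega)).smul (y := x) M (by rwa [abs_of_pos hM])
        have h2 := IsDecodable.sum_range (x := D * x) i fun l hl =>
          (hM' l hl).smul (y := D) (-c l i) (by rw [abs_neg]; exact hc l i)
        have h3 := (h1.add h2).mono (y := ((t + 1) * D) ^ (i + 1)) (by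
          rw [pow_succ, ← hx]
          nlinarith [mul_pos (by omega : 0 < D) hx0])
        convert h3 using 2 with a
        rw [hg i (by omega), mul_add, mul_sum, add_right_comm, ← sum_add_distrib]
        simp only [show ∀ l, M * (c l i * e l a) + -c l i * (M * e l a) = 0 from fun l => by ring]
        simp; ring

end Decoding

section SubspaceDecoding

variable {F V : Type*} [Field F] [AddCommGroup V] [Module F V]

theorem exists_between_finrank_eq [FiniteDimensional F V] {S C : Submodule F V} (h : S ≤ C)
    {d : ℕ} (hS : finrank F S ≤ d) (hC : d ≤ finrank F C) :
    ∃ R : Submodule F V, S ≤ R ∧ R ≤ C ∧ finrank F R = d := by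
  induction d, hS using Nat.le_induction with
  | base => exact ⟨S, le_rfl, h, rfl⟩
  | succ d hd ih =>
    obtain ⟨R, hSR, hRC, hR⟩ := ih (by omega)
    obtain ⟨x, hxC, hxR⟩ : ∃ x ∈ C, x ∉ R := by
      by_contra! hCR
      have := Submodule.finrank_mono (show C ≤ R from hCR)
      omega
    have hx : Submodule.span F {x} ≤ C := by simpa using hxC
    refine ⟨R ⊔ Submodule.span F {x}, hSR.trans le_sup_left, sup_le hRC hx, le_antisymm ?_ ?_⟩
    · have h1 := Submodule.finrank_add_le_finrank_add_finrank R (Submodule.span F {x})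
      have h2 := finrank_span_le_card (R := F) ({x} : Set V)
      simp only [Set.toFinset_singleton, card_singleton] at h2
      omega
    · have : R < R ⊔ Submodule.span F {x} := by
        refine lt_of_le_of_ne le_sup_left fun he => hxR ?_
        rw [he]
        exact Submodule.mem_sup_right (Submodule.mem_span_singleton_self x)
      have := Submodule.finrank_lt_finrank_of_lt this
      omega

theorem finrank_sup_of_disjoint [FiniteDimensional F V] {S C : Submodule F V}
    (h : Disjoint S C) : finrank F (S ⊔ C : Submodule F V) = finrank F S + finrank F C := by
  rw [← Submodule.finrank_sup_add_finrank_inf_eq S C, h.eq_bot, finrank_bot, add_zero]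

theorem exists_subspace_inf_finrank_eq [FiniteDimensional F V] {U W T : Submodule F V} {t k : ℕ}
    (hU : finrank F U = t) (hW : finrank F W = k + t) (hUW : U ≤ W) (hTW : T ≤ W)
    (hT : finrank F T = t) (htk : t ≤ k) :
    ∃ S : Submodule F V, T ≤ S ∧ S ≤ W ∧ finrank F S = k ∧
      finrank F (S ⊓ U : Submodule F V) = finrank F (T ⊓ U : Submodule F V) := by
  obtain ⟨T₁, hT₁, hd, hd₁, hs⟩ := exists_inf_compl T U
  obtain ⟨C, hTC, hC⟩ := hd.exists_isCompl
  have hUC : Disjoint U (C ⊓ W) := hC.disjoint.symm.mono_right inf_le_left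
  have hCW : finrank F (C ⊓ W : Submodule F V) = k := by
    have h1 := finrank_sup_of_disjoint hUC
    rw [← sup_inf_assoc_of_le C hUW, hC.symm.sup_eq_top, top_inf_eq] at h1
    omega
  have hTd := finrank_sup_of_disjoint hd₁
  rw [hs] at hTd
  obtain ⟨R, hTR, hRC, hR⟩ := exists_between_finrank_eq
    (show T₁ ≤ C ⊓ W from le_inf hTC (hT₁.trans hTW))
    (d := k - finrank F (T ⊓ U : Submodule F V)) (by omega) (by omega)
  have hRU : Disjoint R U := (hUC.mono_right hRC).symm
  refine ⟨T ⊓ U ⊔ R, ?_, sup_le (inf_le_left.trans hTW) (hRC.trans inf_le_right), ?_, ?_⟩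
  · calc T = T ⊓ U ⊔ T₁ := hs.symm
      _ ≤ _ := sup_le_sup_left hTR _
  · rw [finrank_sup_of_disjoint (hRU.symm.mono_left inf_le_right), hR]
    have := Submodule.finrank_mono (inf_le_left : T ⊓ U ≤ T)
    omega
  · rw [sup_inf_assoc_of_le R (inf_le_right : T ⊓ U ≤ U), hRU.eq_bot, sup_bot_eq]

theorem exists_linearEquiv_stabilizing [FiniteDimensional F V] {U W T T' : Submodule F V}
    (hUW : U ≤ W) (hTW : T ≤ W) (hTW' : T' ≤ W) (hT : finrank F T = finrank F T')
    (hTU : finrank F (T ⊓ U : Submodule F V) = finrank F (T' ⊓ U : Submodule F V)) :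
    ∃ g : V ≃ₗ[F] V, W.map (g : V →ₗ[F] V) = W ∧ U.map (g : V →ₗ[F] V) = U ∧
      T.map (g : V →ₗ[F] V) = T' := by
  have hc : ∀ {S : Submodule F V}, S ≤ W → finrank F (S.comap W.subtype) = finrank F S :=
    fun hS => (Submodule.comapSubtypeEquivOfLe hS).finrank_eq
  obtain ⟨e, he, he'⟩ := exists_linearEquiv_map_eq_map_eq (F := F) (V := W) (V' := W) rfl
    (U := U.comap W.subtype) (U' := U.comap W.subtype) (T := T.comap W.subtype)
    (T' := T'.comap W.subtype) rfl (by rw [hc hTW, hc hTW', hT])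
    (by rw [← Submodule.comap_inf, ← Submodule.comap_inf, hc (inf_le_left.trans hTW),
      hc (inf_le_left.trans hTW'), hTU])
  obtain ⟨C, hC⟩ := Submodule.exists_isCompl W
  obtain ⟨g, hg, -⟩ := exists_linearEquiv_glue hC hC e (LinearEquiv.refl F C)
  exact ⟨g, map_eq_of_eqOn e g hg le_rfl le_rfl (by simp), map_eq_of_eqOn e g hg hUW hUW he,
    map_eq_of_eqOn e g hg hTW hTW' he'⟩

theorem card_subspaces_le_of_finrank [Finite F] [FiniteDimensional F V] (W : Submodule F V)
    {k t : ℕ} (hW : finrank F W = k + t) (O : Finset (Subspaces F V k)) (hO : ∀ S ∈ O, S.1 ≤ W) :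
    #O ≤ Nat.card F ^ (t * (k + t)) := by
  classical
  have := Module.finite_of_finite F (M := W)
  have : Finite (W →ₗ[F] (Fin t → F)) := DFunLike.finite _
  have hcard : Nat.card (W →ₗ[F] (Fin t → F)) = Nat.card F ^ (t * (k + t)) := by
    rw [Module.natCard_eq_pow_finrank (K := F), finrank_linearMap, hW, finrank_fin_fun, mul_comm]
  have key : ∀ S : O, ∃ f : W →ₗ[F] (Fin t → F), LinearMap.ker f = S.1.1.comap W.subtype := by
    intro S
    have h1 := (Submodule.comapSubtypeEquivOfLe (hO S.1 S.2)).finrank_eq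
    have h2 := Submodule.finrank_quotient_add_finrank (S.1.1.comap W.subtype)
    have e : (W ⧸ S.1.1.comap W.subtype) ≃ₗ[F] (Fin t → F) := LinearEquiv.ofFinrankEq _ _ (by
      rw [finrank_fin_fun]
      have := S.1.2
      omega)
    exact ⟨e.toLinearMap ∘ₗ Submodule.mkQ _, by rw [LinearEquiv.ker_comp, Submodule.ker_mkQ]⟩
  choose f hf using key
  rw [← hcard, ← Fintype.card_coe, ← Nat.card_eq_fintype_card]
  refine Nat.card_le_card_of_injective f fun S S' h => ?_
  have h1 := (hf S).symm.trans ((congrArg LinearMap.ker h).trans (hf S'))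
  refine Subtype.ext (Subtype.ext ?_)
  have h2 := congrArg (Submodule.map W.subtype) h1
  rwa [Submodule.map_comap_subtype, Submodule.map_comap_subtype,
    inf_eq_right.2 (hO _ S.2), inf_eq_right.2 (hO _ S'.2)] at h2

end SubspaceDecoding

section SubspaceDecoding

variable {F V : Type*} [Field F] [AddCommGroup V] [Module F V]

/-- Inclusion as an incidence relation between `t`- and `k`-dimensional subspaces. -/
def subspaceInc (t k : ℕ) (T : Subspaces F V t) (S : Subspaces F V k) : Prop := T.1 ≤ S.1

theorem subspaceInc_smul {t k : ℕ} (g : V ≃ₗ[F] V) (T : Subspaces F V t) (S : Subspaces F V k) :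
    subspaceInc t k (g • T) (g • S) ↔ subspaceInc t k T S :=
  smul_le_smul_subspaces g T S

theorem incidenceDeg_pos_iff {A B : Type*} {I : A → B → Prop} {S : Finset B} {a : A} :
    0 < incidenceDeg I S a ↔ ∃ b ∈ S, I a b := by
  unfold incidenceDeg incidenceInd
  rw [sum_pos_iff_of_nonneg fun b _ => by split_ifs <;> norm_num]
  refine exists_congr fun b => and_congr_right fun _ => ?_
  split_ifs with h <;> simp [h]

theorem incidenceDeg_eq_zero {A B : Type*} {I : A → B → Prop} {S : Finset B} {a : A}
    (h : ∀ b ∈ S, ¬ I a b) : incidenceDeg I S a = 0 :=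
  le_antisymm (not_lt.1 fun hp => let ⟨b, hb, hab⟩ := incidenceDeg_pos_iff.1 hp; h b hb hab)
    (incidenceDeg_nonneg I S a)

open Classical in
theorem exists_isDecodable_single [Finite F] [FiniteDimensional F V] {t k : ℕ}
    [Fintype (Subspaces F V k)] {U W : Submodule F V} (hU : finrank F U = t)
    (hW : finrank F W = k + t) (hUW : U ≤ W) (htk : t ≤ k) :
    ∃ M : ℤ, 0 < M ∧ IsDecodable (subspaceInc t k)
      (fun T : Subspaces F V t => M * if T.1 = U then 1 else 0)
      (((t + 1) * (Nat.card F ^ (t * (k + t)) : ℕ)) ^ (t + 1)) := by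
  set D : ℕ := Nat.card F ^ (t * (k + t)) with hD
  have hD1 : 1 ≤ D := Nat.one_le_pow _ _ Nat.card_pos
  let P : ℕ → Subspaces F V t → Prop :=
    fun i T => T.1 ≤ W ∧ finrank F (T.1 ⊓ U : Submodule F V) = i
  let O : ℕ → Finset (Subspaces F V k) :=
    fun j => univ.filter fun S => S.1 ≤ W ∧ finrank F (S.1 ⊓ U : Submodule F V) = j
  have hO : ∀ {j S}, S ∈ O j ↔ S.1 ≤ W ∧ finrank F (S.1 ⊓ U : Submodule F V) = j := by simp [O]
  have hOD : ∀ j, #(O j) ≤ D :=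
    fun j => card_subspaces_le_of_finrank W hW (O j) fun S hS => (hO.1 hS).1
  let g : ℕ → Subspaces F V t → ℤ := fun j => incidenceDeg (subspaceInc t k) (O j)
  let e : ℕ → Subspaces F V t → ℤ := fun i T => if P i T then 1 else 0
  let c : ℕ → ℕ → ℤ := fun i j =>
    if h : ∃ T, P i T then g j h.choose else if i = j then 1 else 0
  have hinv : ∀ {i j T T'}, P i T → P i T' → g j T = g j T' := by
    intro i j T T' hT hT'
    obtain ⟨l, hlW, hlU, hlT⟩ := exists_linearEquiv_stabilizing hUW hT.1 hT'.1
      (T.2.trans T'.2.symm) (hT.2.trans hT'.2.symm)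
    have h1 := incidenceDeg_image_smul (I := subspaceInc t k) subspaceInc_smul l (O j) T'
    have h2 : l⁻¹ • T' = T := by
      rw [inv_smul_eq_iff]
      exact Subtype.ext hlT.symm
    rw [h2] at h1
    refine h1.symm.trans (congrArg (incidenceDeg (subspaceInc t k) · T') ?_)
    refine eq_of_subset_of_card_le (fun S hS => ?_)
      (card_image_of_injective _ (MulAction.injective l)).ge
    obtain ⟨R, hR, rfl⟩ := mem_image.1 hS
    have hR' := hO.1 hR
    refine hO.2 ⟨?_, ?_⟩
    · rw [coe_smul_subspaces, ← hlW]
      exact Submodule.map_mono hR'.1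
    · rw [coe_smul_subspaces, ← hR'.2]
      conv_lhs => rw [← hlU]
      rw [← Submodule.map_inf _ l.injective]
      exact finrank_map_linearEquiv l _
  have hcg : ∀ {i j T}, P i T → c i j = g j T := by
    intro i j T hT
    have h : ∃ T, P i T := ⟨T, hT⟩
    simp only [c, dif_pos h]
    exact hinv h.choose_spec hT
  have hzero : ∀ {i j T}, P i T → j < i → g j T = 0 := by
    intro i j T hT hij
    refine incidenceDeg_eq_zero fun S hS hTS => ?_
    have h1 := Submodule.finrank_mono (inf_le_inf_right U (show T.1 ≤ S.1 from hTS))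
    have h2 := hT.2
    have h3 := (hO.1 hS).2
    omega
  have hcabs : ∀ i j, |c i j| ≤ (D : ℤ) := by
    intro i j
    simp only [c]
    have hD1' : (1 : ℤ) ≤ D := by exact_mod_cast hD1
    split_ifs with h
    · rw [abs_of_nonneg (incidenceDeg_nonneg _ _ _)]
      exact (incidenceDeg_le_card _ _ _).trans (by exact_mod_cast hOD j)
    · simpa using hD1'
    · simp
  have hpos : ∀ j, 0 < c j j := by
    intro j
    by_cases h : ∃ T, P j T
    · obtain ⟨T, hT⟩ := h
      rw [hcg hT, incidenceDeg_pos_iff]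
      obtain ⟨S, hTS, hSW, hSk, hSU⟩ :=
        exists_subspace_inf_finrank_eq hU hW hUW hT.1 T.2 htk
      exact ⟨⟨S, hSk⟩, hO.2 ⟨hSW, hSU.trans hT.2⟩, hTS⟩
    · simp only [c, dif_neg h, if_true, zero_lt_one]
  have hgsum : ∀ j ≤ t, ∀ T, g j T = ∑ i ∈ range j, c i j * e i T + c j j * e j T := by
    intro j _ T
    rw [← sum_range_succ (fun i => c i j * e i T)]
    by_cases hTW : T.1 ≤ W
    · set i₀ := finrank F (T.1 ⊓ U : Submodule F V) with hi₀
      have hP : P i₀ T := ⟨hTW, hi₀.symm⟩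
      have he : ∀ i, c i j * e i T = if i = i₀ then g j T else 0 := by
        intro i
        by_cases hi : i = i₀
        · subst hi
          simp only [e, if_pos hP, if_true, mul_one]
          exact hcg hP
        · have : ¬ P i T := fun h => hi (h.2.symm.trans hi₀.symm)
          simp [e, this, hi]
      simp only [he, sum_ite_eq', mem_range]
      split_ifs with h
      · rfl
      · exact hzero hP (by omega)
    · have he : ∀ i, e i T = 0 := fun i => if_neg fun h => hTW h.1
      simp only [he, mul_zero, sum_const_zero]
      exact incidenceDeg_eq_zero fun S hS hTS => hTW (le_trans hTS (hO.1 hS).1)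
  obtain ⟨M, hM, -, hM'⟩ := exists_isDecodable_of_triangular (I := subspaceInc t k) e g c D t
    hgsum hcabs hpos
    (fun j _ => (isDecodable_incidenceDeg _ (O j)).mono (by exact_mod_cast hOD j)) (t + 1) le_rfl
  refine ⟨M, hM, ?_⟩
  convert hM' t (by omega) using 3 with T
  have : T.1 = U ↔ P t T := by
    constructor
    · intro h
      exact ⟨h ▸ hUW, by rw [h, inf_idem, hU]⟩
    · intro h
      have h1 : T.1 ⊓ U = T.1 :=
        Submodule.eq_of_le_of_finrank_eq inf_le_left (h.2.trans T.2.symm)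
      exact Submodule.eq_of_le_of_finrank_eq (inf_eq_left.1 h1) (T.2.trans hU.symm)
  simp only [e, this]

end SubspaceDecoding

section Trade

theorem exists_finset_card_eq_sub_notMem {M : Type*} [AddCommGroup M] [Fintype M] [DecidableEq M]
    (Z : Finset M) (h0 : 0 ∈ Z) (hneg : ∀ z ∈ Z, -z ∈ Z) :
    ∀ s : ℕ, s * #Z ≤ Fintype.card M →
      ∃ C : Finset M, #C = s ∧ ∀ f ∈ C, ∀ g ∈ C, f ≠ g → f - g ∉ Z
  | 0, _ => ⟨∅, by simp⟩
  | s + 1, hs => by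
    have hZ : 0 < #Z := card_pos.2 ⟨0, h0⟩
    obtain ⟨C, hC, hCZ⟩ := exists_finset_card_eq_sub_notMem Z h0 hneg s
      ((Nat.mul_le_mul_right _ (Nat.le_succ s)).trans hs)
    have hlt : #(C.biUnion fun f => Z.image (f + ·)) < #(univ : Finset M) := by
      refine (card_biUnion_le_card_mul _ _ #Z fun f _ => card_image_le).trans_lt ?_
      rw [hC, card_univ]
      nlinarith
    obtain ⟨g, -, hg⟩ := exists_mem_notMem_of_card_lt_card hlt
    have hgZ : ∀ f ∈ C, g - f ∉ Z := fun f hf h => hg <|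
      mem_biUnion.2 ⟨f, hf, mem_image.2 ⟨g - f, h, by abel⟩⟩
    have hgC : g ∉ C := fun h => hgZ g h (by simpa using h0)
    refine ⟨insert g C, by rw [card_insert_of_notMem hgC, hC], ?_⟩
    intro f hf f' hf' hne
    rcases mem_insert.1 hf with rfl | hfC <;> rcases mem_insert.1 hf' with rfl | hfC'
    · exact absurd rfl hne
    · exact hgZ f' hfC'
    · exact fun h => hgZ f hfC (by simpa using hneg _ h)
    · exact hCZ f hfC f' hfC' hne

theorem cube_add_one_pow_lt {R : ℕ} (hR : 3 < R) : (R ^ 3 + 1) ^ R < 2 ^ R ^ 3 := by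
  have h1 : R ^ 3 + 1 ≤ (R + 1) ^ 3 := by nlinarith
  have h2 : R + 1 ≤ 2 ^ R := Nat.lt_two_pow_self
  calc (R ^ 3 + 1) ^ R ≤ ((2 ^ R) ^ 3) ^ R :=
        Nat.pow_le_pow_left (h1.trans (Nat.pow_le_pow_left h2 3)) R
    _ = 2 ^ (R * (3 * R)) := by rw [← pow_mul, ← pow_mul]
    _ < 2 ^ R ^ 3 := Nat.pow_lt_pow_right (by norm_num) (by
        have : 0 < R * R := Nat.mul_pos (by omega) (by omega)
        nlinarith)

/-- Few zero-one types force two different subfamilies with the same counts. -/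
theorem exists_ne_sum_eq_of_pow_lt {M τ : Type*} [DecidableEq M] [Fintype τ] (C : Finset M)
    (w : τ → M → Prop) [∀ a, DecidablePred (w a)] (h : (#C + 1) ^ Fintype.card τ < 2 ^ #C) :
    ∃ S₁ ⊆ C, ∃ S₂ ⊆ C, S₁ ≠ S₂ ∧ ∀ a, #(S₁.filter (w a)) = #(S₂.filter (w a)) := by
  classical
  have hmaps : ∀ S ∈ C.powerset, (fun a => #(S.filter (w a))) ∈
      Fintype.piFinset fun _ : τ => range (#C + 1) := by
    intro S hS
    simp only [Fintype.mem_piFinset, mem_range]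
    exact fun a => Nat.lt_succ_of_le
      ((card_filter_le _ _).trans (card_le_card (mem_powerset.1 hS)))
  obtain ⟨S₁, h1, S₂, h2, hne, he⟩ := exists_ne_map_eq_of_card_lt_of_maps_to
    (by simpa [Fintype.card_piFinset, card_powerset] using h) hmaps
  exact ⟨S₁, mem_powerset.1 h1, S₂, mem_powerset.1 h2, hne, fun a => congrFun he a⟩

variable {F : Type*} [Field F]

theorem exists_injective_linearMap {X Y : Type*} [AddCommGroup X] [Module F X]
    [AddCommGroup Y] [Module F Y] [FiniteDimensional F X] [FiniteDimensional F Y]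
    (h : finrank F X ≤ finrank F Y) : ∃ f : X →ₗ[F] Y, Function.Injective f := by
  obtain ⟨R, -, -, hR⟩ := exists_between_finrank_eq (F := F) (V := Y) (S := ⊥) (C := ⊤) bot_le
    (d := finrank F X) (by simp) (by rwa [finrank_top])
  exact ⟨R.subtype ∘ₗ (LinearEquiv.ofFinrankEq X R hR.symm).toLinearMap,
    Subtype.val_injective.comp (LinearEquiv.injective _)⟩

theorem card_rank_le [Finite F] {E : Type*} [AddCommGroup E] [Module F E]
    [FiniteDimensional F E] (t : ℕ) [Fintype (E →ₗ[F] E)] [DecidableEq (E →ₗ[F] E)] :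
    #{h : E →ₗ[F] E | finrank F (LinearMap.range h) ≤ t} ≤
      Nat.card F ^ (2 * (finrank F E * t)) := by
  have := Module.finite_of_finite F (M := E)
  have : Finite (E →ₗ[F] (Fin t → F)) := DFunLike.finite _
  have : Finite ((Fin t → F) →ₗ[F] E) := DFunLike.finite _
  have hcard : Nat.card ((E →ₗ[F] (Fin t → F)) × ((Fin t → F) →ₗ[F] E)) =
      Nat.card F ^ (2 * (finrank F E * t)) := by
    rw [Nat.card_prod, Module.natCard_eq_pow_finrank (K := F) (V := E →ₗ[F] (Fin t → F)),
      Module.natCard_eq_pow_finrank (K := F) (V := (Fin t → F) →ₗ[F] E), finrank_linearMap, finrank_linearMap,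
      finrank_fin_fun, ← pow_add]
    ring_nf
  have key : ∀ h : {h // h ∈ ({h | finrank F (LinearMap.range h) ≤ t} : Finset (E →ₗ[F] E))},
      ∃ p : (E →ₗ[F] (Fin t → F)) × ((Fin t → F) →ₗ[F] E), p.2 ∘ₗ p.1 = h.1 := by
    rintro ⟨h, hh⟩
    rw [mem_filter] at hh
    obtain ⟨j, hj⟩ := exists_injective_linearMap (X := LinearMap.range h) (Y := Fin t → F)
      (by rw [finrank_fin_fun]; exact hh.2)
    obtain ⟨r, hr⟩ := j.exists_leftInverse_of_injective (LinearMap.ker_eq_bot.2 hj)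
    refine ⟨⟨j ∘ₗ h.rangeRestrict, (LinearMap.range h).subtype ∘ₗ r⟩, LinearMap.ext fun x => ?_⟩
    exact congrArg Subtype.val (LinearMap.congr_fun hr (h.rangeRestrict x))
  choose p hp using key
  rw [← hcard, ← Fintype.card_coe, ← Nat.card_eq_fintype_card]
  refine Nat.card_le_card_of_injective p fun h h' he => Subtype.ext ?_
  rw [← hp h, ← hp h', he]

end Trade

section GraphSubspace

variable {F V X E E' : Type*} [Field F] [AddCommGroup V] [Module F V] [AddCommGroup X] [Module F X]
  [AddCommGroup E] [Module F E] [AddCommGroup E'] [Module F E']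

/-- The image in `V` of the product of `X` with the graph of `f`. -/
def graphSubspace (ι : X × E × E' →ₗ[F] V) (f : E →ₗ[F] E') : Submodule F V :=
  LinearMap.range (ι ∘ₗ LinearMap.prodMap LinearMap.id (LinearMap.prod LinearMap.id f))

variable {ι : X × E × E' →ₗ[F] V}

theorem mem_graphSubspace {f : E →ₗ[F] E'} {v : V} :
    v ∈ graphSubspace ι f ↔ ∃ x e, ι (x, e, f e) = v := by
  simp [graphSubspace]

theorem apply_mem_graphSubspace (hι : Function.Injective ι) {f : E →ₗ[F] E'} {x : X} {e : E} {c : E'} :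
    ι (x, e, c) ∈ graphSubspace ι f ↔ f e = c := by
  rw [mem_graphSubspace]
  constructor
  · rintro ⟨x', e', h⟩
    have := hι h
    simp only [Prod.mk.injEq] at this
    obtain ⟨-, rfl, rfl⟩ := this
    rfl
  · rintro rfl
    exact ⟨x, e, rfl⟩

theorem graphSubspace_le_range (f : E →ₗ[F] E') : graphSubspace ι f ≤ LinearMap.range ι :=
  LinearMap.range_comp_le_range _ _

theorem graphSubspace_injective (hι : Function.Injective ι) :
    Function.Injective (graphSubspace ι) := by
  intro f g h
  ext e
  have h1 : ι (0, e, f e) ∈ graphSubspace ι f := (apply_mem_graphSubspace hι).2 rfl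
  rw [h] at h1
  exact ((apply_mem_graphSubspace hι).1 h1).symm

variable [FiniteDimensional F X] [FiniteDimensional F E]

theorem finrank_graphSubspace (hι : Function.Injective ι) (f : E →ₗ[F] E') :
    finrank F (graphSubspace ι f) = finrank F X + finrank F E := by
  rw [graphSubspace, LinearMap.finrank_range_of_inj, finrank_prod]
  intro a b h
  have := hι h
  simp only [LinearMap.prodMap_apply, LinearMap.prod_apply] at this
  simp only [Prod.ext_iff] at this ⊢
  exact ⟨this.1, this.2.1⟩

theorem finrank_graphSubspace_inf_le (hι : Function.Injective ι) (f g : E →ₗ[F] E') :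
    finrank F (graphSubspace ι f ⊓ graphSubspace ι g : Submodule F V) ≤
      finrank F X + finrank F (LinearMap.ker (f - g)) := by
  let φ : X × LinearMap.ker (f - g) →ₗ[F] V :=
    ι ∘ₗ LinearMap.prodMap LinearMap.id (LinearMap.prod LinearMap.id f) ∘ₗ
      LinearMap.prodMap LinearMap.id (LinearMap.ker (f - g)).subtype
  have h : graphSubspace ι f ⊓ graphSubspace ι g ≤ LinearMap.range φ := by
    rintro v ⟨hf, hg⟩
    obtain ⟨x, e, rfl⟩ := mem_graphSubspace.1 hf
    have he := (apply_mem_graphSubspace hι).1 hg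
    exact ⟨⟨x, e, by simp [he]⟩, by simp [φ]⟩
  refine (Submodule.finrank_mono h).trans ((LinearMap.finrank_range_le φ).trans ?_)
  rw [finrank_prod]

theorem lt_finrank_graphSubspace_sup [FiniteDimensional F V] (hι : Function.Injective ι)
    {f g : E →ₗ[F] E'} {t : ℕ} (h : t < finrank F (LinearMap.range (f - g))) :
    finrank F X + finrank F E + t <
      finrank F (graphSubspace ι f ⊔ graphSubspace ι g : Submodule F V) := by
  have h1 := Submodule.finrank_sup_add_finrank_inf_eq (graphSubspace ι f) (graphSubspace ι g)
  have h2 := finrank_graphSubspace_inf_le hι f g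
  have h3 := LinearMap.finrank_range_add_finrank_ker (f - g)
  rw [finrank_graphSubspace hι, finrank_graphSubspace hι] at h1
  omega

theorem finrank_graphSubspace_sup_le [FiniteDimensional F E'] [FiniteDimensional F V] (f g : E →ₗ[F] E') :
    finrank F (graphSubspace ι f ⊔ graphSubspace ι g : Submodule F V) ≤
      finrank F X + finrank F E + finrank F E' := by
  refine (Submodule.finrank_mono
    (sup_le (graphSubspace_le_range f) (graphSubspace_le_range g))).trans
    ((LinearMap.finrank_range_le ι).trans ?_)
  rw [finrank_prod, finrank_prod]
  omega

omit [FiniteDimensional F X] [FiniteDimensional F E] in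
/-- Whether `T` lies in a graph subspace is a finite list of evaluation conditions. -/
theorem exists_le_graphSubspace_iff (hι : Function.Injective ι) [FiniteDimensional F V]
    {t : ℕ} (T : Subspaces F V t) :
    (∃ τ : Fin t → E × E', ∀ f, T.1 ≤ graphSubspace ι f ↔ ∀ i, f (τ i).1 = (τ i).2) ∨
      ∀ f, ¬ T.1 ≤ graphSubspace ι f := by
  by_cases hT : T.1 ≤ LinearMap.range ι
  · left
    let v := finBasisOfFinrankEq F T.1 T.2
    choose y hy using fun i => hT (v i).2
    refine ⟨fun i => (y i).2, fun f => ?_⟩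
    have hmem : ∀ i, f (y i).2.1 = (y i).2.2 ↔ (v i : V) ∈ graphSubspace ι f := fun i => by
      rw [← hy i, ← apply_mem_graphSubspace hι (x := (y i).1)]
    simp only [hmem]
    refine ⟨fun h i => h (v i).2, fun h => ?_⟩
    have hspan : T.1 = Submodule.span F (Set.range fun i => (v i : V)) := by
      rw [show (fun i => (v i : V)) = T.1.subtype ∘ v from rfl, Set.range_comp,
        Submodule.span_image, v.span_eq, Submodule.map_subtype_top]
    rw [hspan, Submodule.span_le]
    rintro _ ⟨i, rfl⟩
    exact h i
  · exact Or.inr fun f h => hT (h.trans (graphSubspace_le_range f))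

end GraphSubspace

section Trade

variable {F V : Type*} [Field F] [AddCommGroup V] [Module F V]

theorem exists_finset_rank_sub_gt [Finite F] {E : Type*} [AddCommGroup E] [Module F E]
    [FiniteDimensional F E] (t s : ℕ)
    (hs : s * Nat.card F ^ (2 * (finrank F E * t)) ≤ Nat.card F ^ (finrank F E * finrank F E)) :
    ∃ C : Finset (E →ₗ[F] E), #C = s ∧
      ∀ f ∈ C, ∀ g ∈ C, f ≠ g → t < finrank F (LinearMap.range (f - g)) := by
  classical
  have := Module.finite_of_finite F (M := E)
  have : Finite (E →ₗ[F] E) := DFunLike.finite _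
  have := Fintype.ofFinite (E →ₗ[F] E)
  have hcard : Fintype.card (E →ₗ[F] E) = Nat.card F ^ (finrank F E * finrank F E) := by
    rw [← Nat.card_eq_fintype_card, Module.natCard_eq_pow_finrank (K := F), finrank_linearMap]
  obtain ⟨C, hC, hCZ⟩ := exists_finset_card_eq_sub_notMem
    ({h | finrank F (LinearMap.range h) ≤ t} : Finset (E →ₗ[F] E))
    (mem_filter.2 ⟨mem_univ _, by rw [LinearMap.range_zero, finrank_bot]; exact t.zero_le⟩)
    (fun z hz => mem_filter.2 ⟨mem_univ _, by
      rw [LinearMap.range_neg]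
      exact (mem_filter.1 hz).2⟩) s (by
        rw [hcard]
        exact (Nat.mul_le_mul_left _ (card_rank_le t)).trans hs)
  refine ⟨C, hC, fun f hf g hg hfg => not_le.1 fun h => hCZ f hf g hg hfg ?_⟩
  exact mem_filter.2 ⟨mem_univ _, h⟩

theorem exists_null_trade [Finite F] [FiniteDimensional F V] {t k : ℕ} (ht : 0 < t)
    (hk : 8 * t ≤ k) (hV : k + 8 * t ≤ finrank F V) [DecidableEq (Subspaces F V k)] :
    ∃ N₁ N₂ : Finset (Subspaces F V k), Disjoint N₁ N₂ ∧ N₁.Nonempty ∧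
      #(N₁ ∪ N₂) ≤ Nat.card F ^ (48 * t ^ 2) ∧
      (∀ T, incidenceDeg (subspaceInc t k) N₁ T = incidenceDeg (subspaceInc t k) N₂ T) ∧
      ∀ b ∈ N₁ ∪ N₂, ∀ b' ∈ N₁ ∪ N₂, b ≠ b' →
        k + t < finrank F (b.1 ⊔ b'.1 : Submodule F V) ∧
        finrank F (b.1 ⊔ b'.1 : Submodule F V) ≤ k + 8 * t := by
  classical
  let X := Fin (k - 8 * t) → F
  let E := Fin (8 * t) → F
  have hX : finrank F X = k - 8 * t := finrank_fin_fun F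
  have hE : finrank F E = 8 * t := finrank_fin_fun F
  obtain ⟨ι, hι⟩ := exists_injective_linearMap (F := F) (X := X × E × E) (Y := V) (by
    rw [finrank_prod, finrank_prod, hX, hE]; omega)
  have := Fintype.ofFinite E
  obtain ⟨q, hq⟩ : ∃ q, q = Nat.card F := ⟨_, rfl⟩
  have hq2 : 2 ≤ q := hq ▸ Finite.one_lt_card
  have hcardE : Fintype.card (Fin t → E × E) = q ^ (16 * t ^ 2) := by
    rw [Fintype.card_fun, Fintype.card_prod, ← Nat.card_eq_fintype_card,
      Module.natCard_eq_pow_finrank (K := F) (V := E), hE, Fintype.card_fin, ← pow_add, ← pow_mul,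
      ← hq]
    ring_nf
  obtain ⟨C, hC, hCZ⟩ := exists_finset_rank_sub_gt (F := F) (E := E) t (q ^ (48 * t ^ 2)) (by
    rw [hE, ← hq, ← pow_add]
    exact le_of_eq (by ring_nf))
  rw [← hq]
  let Y : (E →ₗ[F] E) → Subspaces F V k := fun f => ⟨graphSubspace ι f, by
    rw [finrank_graphSubspace hι, hX, hE]; omega⟩
  have hY : Function.Injective Y := fun f g h => graphSubspace_injective hι (congrArg Subtype.val h)
  obtain ⟨S₁, hS₁, S₂, hS₂, hne, hS⟩ := exists_ne_sum_eq_of_pow_lt C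
    (fun (τ : Fin t → E × E) (f : E →ₗ[F] E) => ∀ i, f (τ i).1 = (τ i).2) (by
      rw [hcardE, hC, show q ^ (48 * t ^ 2) = (q ^ (16 * t ^ 2)) ^ 3 by rw [← pow_mul]; ring_nf]
      refine cube_add_one_pow_lt ?_
      have h1 : 2 ≤ 16 * t ^ 2 := by nlinarith
      calc 3 < 2 ^ 2 := by norm_num
        _ ≤ q ^ 2 := Nat.pow_le_pow_left hq2 2
        _ ≤ _ := Nat.pow_le_pow_right (by omega) h1)
  have hdeg : ∀ T, incidenceDeg (subspaceInc t k) (S₁.image Y) T =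
      incidenceDeg (subspaceInc t k) (S₂.image Y) T := by
    intro T
    unfold incidenceDeg incidenceInd
    rw [sum_image hY.injOn, sum_image hY.injOn, sum_boole, sum_boole]
    congr 1
    rcases exists_le_graphSubspace_iff hι T with ⟨τ, hτ⟩ | hτ
    · have h1 : ∀ f, subspaceInc t k T (Y f) ↔ ∀ i, f (τ i).1 = (τ i).2 := hτ
      simp only [h1]
      convert hS τ
    · have h1 : ∀ f, ¬ subspaceInc t k T (Y f) := hτ
      simp [h1]
  have hsub : (S₁.image Y \ S₂.image Y) ∪ (S₂.image Y \ S₁.image Y) ⊆ C.image Y :=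
    union_subset (sdiff_subset.trans (image_subset_image hS₁))
      (sdiff_subset.trans (image_subset_image hS₂))
  have hcard : #((S₁.image Y \ S₂.image Y) ∪ (S₂.image Y \ S₁.image Y)) ≤ q ^ (48 * t ^ 2) :=
    (card_le_card hsub).trans (card_image_le.trans hC.le)
  have hsep : ∀ b ∈ (S₁.image Y \ S₂.image Y) ∪ (S₂.image Y \ S₁.image Y),
      ∀ b' ∈ (S₁.image Y \ S₂.image Y) ∪ (S₂.image Y \ S₁.image Y), b ≠ b' →
        k + t < finrank F (b.1 ⊔ b'.1 : Submodule F V) ∧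
        finrank F (b.1 ⊔ b'.1 : Submodule F V) ≤ k + 8 * t := by
    intro b hb b' hb' hbb
    obtain ⟨f, hf, rfl⟩ := mem_image.1 (hsub hb)
    obtain ⟨g, hg, rfl⟩ := mem_image.1 (hsub hb')
    have hfg := hCZ f hf g hg fun h => hbb (h ▸ rfl)
    have h1 := lt_finrank_graphSubspace_sup hι hfg
    have h2 := finrank_graphSubspace_sup_le (ι := ι) f g
    rw [hX, hE] at h1 h2
    exact ⟨by simp only [Y]; omega, by simp only [Y]; omega⟩
  have hdeg' : ∀ T, incidenceDeg (subspaceInc t k) (S₁.image Y \ S₂.image Y) T =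
      incidenceDeg (subspaceInc t k) (S₂.image Y \ S₁.image Y) T := by
    intro T
    have h := hdeg T
    unfold incidenceDeg at h ⊢
    exact (sum_sdiff_eq_sum_sdiff_iff).2 h
  have hne' : S₁.image Y ≠ S₂.image Y := fun h => hne (image_injective hY h)
  by_cases hN : (S₁.image Y \ S₂.image Y).Nonempty
  · exact ⟨_, _, disjoint_sdiff_sdiff, hN, hcard, hdeg', hsep⟩
  · refine ⟨_, _, disjoint_sdiff_sdiff, ?_, union_comm _ (_ : Finset (Subspaces F V k)) ▸ hcard,
      fun T => (hdeg' T).symm, union_comm _ (_ : Finset (Subspaces F V k)) ▸ hsep⟩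
    rw [not_nonempty_iff_eq_empty, sdiff_eq_empty_iff_subset] at hN
    rw [sdiff_nonempty]
    exact fun h => hne' (hN.antisymm h)

end Trade

section Superspaces

variable {F V : Type*} [Field F] [AddCommGroup V] [Module F V] [Finite F] [FiniteDimensional F V]

theorem pow_le_card_superspaces (b : Submodule F V) {r s : ℕ}
    (h : finrank F b + r + s = finrank F V) :
    Nat.card F ^ (r * s) ≤
      Nat.card {Y : Submodule F V // b ≤ Y ∧ finrank F Y = finrank F b + r} := by
  have := Module.finite_of_finite F (M := V)
  have : Finite (Submodule F V) := Finite.of_injective _ SetLike.coe_injective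
  obtain ⟨C, hC⟩ := Submodule.exists_isCompl b
  have hCr := Submodule.finrank_add_eq_of_isCompl hC
  let e : ((Fin r → F) × (Fin s → F)) ≃ₗ[F] C := LinearEquiv.ofFinrankEq _ _ (by
    rw [finrank_prod, finrank_fin_fun, finrank_fin_fun]; omega)
  let ι : (b × (Fin r → F) × (Fin s → F)) ≃ₗ[F] V :=
    ((LinearEquiv.refl F b).prodCongr e) ≪≫ₗ b.prodEquivOfIsCompl C hC
  have hι : Function.Injective ι.toLinearMap := ι.injective
  have hcard : Nat.card ((Fin r → F) →ₗ[F] (Fin s → F)) = Nat.card F ^ (r * s) := by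
    rw [Module.natCard_eq_pow_finrank (K := F), finrank_linearMap, finrank_fin_fun,
      finrank_fin_fun]
  rw [← hcard]
  refine Nat.card_le_card_of_injective
    (fun f => ⟨graphSubspace ι.toLinearMap f, fun x hx => ?_, ?_⟩) fun f g hfg =>
    graphSubspace_injective hι (congrArg Subtype.val hfg)
  · exact mem_graphSubspace.2 ⟨⟨x, hx⟩, 0, by simp [ι]⟩
  · rw [finrank_graphSubspace hι, finrank_fin_fun]

theorem pow_le_card_subspaces {k : ℕ} (h : k ≤ finrank F V) :
    Nat.card F ^ (k * (finrank F V - k)) ≤ Nat.card (Subspaces F V k) := by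
  refine (pow_le_card_superspaces (⊥ : Submodule F V) (r := k) (s := finrank F V - k)
    (by rw [finrank_bot]; omega)).trans_eq ?_
  simp [Subspaces]

/-- Prescribing the image of a second subspace is much more restrictive than prescribing the
image of the first one only. -/
theorem pow_mul_card_smul_eq_le {k r s : ℕ} (h : k + r + s = finrank F V)
    (b₀ b' b c : Subspaces F V k) (hr : finrank F (b₀.1 ⊔ b'.1 : Submodule F V) = k + r) :
    Nat.card F ^ (r * s) * Nat.card {g : V ≃ₗ[F] V // g • b₀ = b ∧ g • b' = c} ≤
      Nat.card {g : V ≃ₗ[F] V // g • b₀ = b} := by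
  have := Module.finite_of_finite F (M := V)
  have : Finite (V ≃ₗ[F] V) := Finite.of_injective _ DFunLike.coe_injective
  by_cases hX : IsEmpty {g : V ≃ₗ[F] V // g • b₀ = b ∧ g • b' = c}
  · simp
  rw [not_isEmpty_iff] at hX
  have hsup : ∀ g : {g : V ≃ₗ[F] V // g • b₀ = b ∧ g • b' = c},
      (b₀.1 ⊔ b'.1).map (g.1 : V →ₗ[F] V) = b.1 ⊔ c.1 := by
    rintro ⟨g, rfl, rfl⟩
    rw [Submodule.map_sup]
    rfl
  have hbc : finrank F (b.1 ⊔ c.1 : Submodule F V) = k + r := by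
    obtain ⟨g⟩ := hX
    rw [← hsup g, finrank_map_linearEquiv, hr]
  have hY : ∀ Y : {Y : Submodule F V // b.1 ≤ Y ∧ finrank F Y = finrank F b.1 + r},
      ∃ g : V ≃ₗ[F] V, g • b = b ∧ (b.1 ⊔ c.1).map (g : V →ₗ[F] V) = Y.1 := by
    intro Y
    obtain ⟨g, hg, hg'⟩ := exists_linearEquiv_map_eq_map_eq (F := F) (V := V) (V' := V) rfl
      (U := b.1) (U' := b.1) (T := b.1 ⊔ c.1) (T' := Y.1) rfl (by rw [hbc, Y.2.2, b.2])
      (by rw [inf_eq_right.2 le_sup_left, inf_eq_right.2 Y.2.1])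
    exact ⟨g, Subtype.ext hg, hg'⟩
  choose l hl hl' using hY
  refine (Nat.mul_le_mul_right _ (pow_le_card_superspaces b.1 (r := r) (s := s)
    (by rw [b.2, h]))).trans ?_
  rw [← Nat.card_prod]
  refine Nat.card_le_card_of_injective (fun p => ⟨l p.1 * p.2.1, ?_⟩) ?_
  · rw [mul_smul, p.2.2.1, hl]
  · rintro ⟨Y, g⟩ ⟨Y', g'⟩ he
    have he' : l Y * g.1 = l Y' * g'.1 := congrArg Subtype.val he
    have hmap : ∀ (Y : {Y : Submodule F V // b.1 ≤ Y ∧ finrank F Y = finrank F b.1 + r})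
        (g : {g : V ≃ₗ[F] V // g • b₀ = b ∧ g • b' = c}),
        (b₀.1 ⊔ b'.1).map ((l Y * g.1 : V ≃ₗ[F] V) : V →ₗ[F] V) = Y.1 := fun Y g => by
      rw [← hl' Y, ← hsup g, ← Submodule.map_comp]
      rfl
    have hYY : Y = Y' := Subtype.ext (by rw [← hmap Y g, he', hmap])
    subst hYY
    exact Prod.ext rfl (Subtype.ext (mul_left_cancel he'))

end Superspaces

section Assembly

variable {F V : Type*} [Field F] [AddCommGroup V] [Module F V] [Finite F] [FiniteDimensional F V]

theorem card_subspaces_le_pow (t : ℕ) :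
    Nat.card (Subspaces F V t) ≤ Nat.card F ^ (t * finrank F V) := by
  have := Module.finite_of_finite F (M := V)
  have hcard : Nat.card (Fin t → V) = Nat.card F ^ (t * finrank F V) := by
    rw [Nat.card_fun, Nat.card_fin, Module.natCard_eq_pow_finrank (K := F) (V := V), ← pow_mul,
      mul_comm]
  rw [← hcard]
  let v : ∀ T : Subspaces F V t, Basis (Fin t) F T.1 := fun T => finBasisOfFinrankEq F T.1 T.2
  have hspan : ∀ T : Subspaces F V t, Submodule.span F (Set.range fun i => (v T i : V)) = T.1 := by
    intro T
    rw [show (fun i => (v T i : V)) = T.1.subtype ∘ v T from rfl, Set.range_comp,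
      Submodule.span_image, (v T).span_eq, Submodule.map_subtype_top]
  refine Nat.card_le_card_of_injective (fun T i => (v T i : V)) fun T T' h => Subtype.ext ?_
  rw [← hspan T, ← hspan T']
  exact congrArg (fun w : Fin t → V => Submodule.span F (Set.range w)) h

theorem exists_switch {t k n : ℕ} (ht : 0 < t) (hk : 12 * (t + 1) < k) (hn : 1000 * k * t ≤ n)
    (hV : finrank F V = n) [Fintype (Subspaces F V k)] [DecidableEq (Subspaces F V t)] :
    ∃ (P Q : Finset (Subspaces F V k)) (u : Subspaces F V t) (m : ℕ), 0 < m ∧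
      #P + #Q ≤ Nat.card F ^ (4 * k * t * (t + 1)) ∧
      ∀ T, incidenceDeg (subspaceInc t k) P T =
        incidenceDeg (subspaceInc t k) Q T + if T = u then (m : ℤ) else 0 := by
  classical
  have := Module.finite_of_finite F (M := V)
  have : Finite (V ≃ₗ[F] V) := Finite.of_injective _ DFunLike.coe_injective
  have := Fintype.ofFinite (V ≃ₗ[F] V)
  obtain ⟨q, hq⟩ : ∃ q, q = Nat.card F := ⟨_, rfl⟩
  have hq2 : 2 ≤ q := hq ▸ Finite.one_lt_card
  have hkt : 1000 * k ≤ n := by nlinarith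
  have hpow : ∀ {a b : ℕ}, a ≤ b → q ^ a ≤ q ^ b := fun h => Nat.pow_le_pow_right (by omega) h
  obtain ⟨U, -, -, hU⟩ := exists_between_finrank_eq (F := F) (V := V) (S := ⊥) (C := ⊤) bot_le
    (d := t) (by simp) (by rw [finrank_top, hV]; omega)
  obtain ⟨W, hUW, -, hW⟩ := exists_between_finrank_eq (F := F) (V := V) (S := U) (C := ⊤) le_top
    (d := k + t) (by omega) (by rw [finrank_top, hV]; omega)
  obtain ⟨M, hM, γ, hγ, hγ'⟩ := exists_isDecodable_single hU hW hUW (by omega : t ≤ k)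
  obtain ⟨N₁, N₂, hd, ⟨b₀, hb₀⟩, hNcard, hN, hsep⟩ :=
    exists_null_trade (F := F) (V := V) (k := k) ht (by omega) (by omega)
  rw [← hq] at hNcard hγ'
  have hL : ∑ b, |γ b| ≤ (q ^ (t * (k + t + 1) * (t + 1)) : ℕ) := by
    refine hγ'.trans ?_
    have h1 : t + 1 ≤ q ^ t := Nat.lt_pow_self hq2
    have h2 : (t + 1) * q ^ (t * (k + t)) ≤ q ^ (t * (k + t + 1)) := by
      refine (Nat.mul_le_mul_right _ h1).trans_eq ?_
      rw [← pow_add]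
      ring_nf
    have h3 := Nat.pow_le_pow_left h2 (t + 1)
    rw [← pow_mul] at h3
    exact_mod_cast h3
  have hκ : ∀ b' ∈ N₁ ∪ N₂, b' ≠ b₀ → ∀ b c : Subspaces F V k,
      q ^ ((t + 1) * (n - k - 8 * t)) *
        Nat.card {g : V ≃ₗ[F] V // g • b₀ = b ∧ g • b' = c} ≤
      Nat.card {g : V ≃ₗ[F] V // g • b₀ = b} := by
    intro b' hb' hne b c
    obtain ⟨h1, h2⟩ := hsep b₀ (mem_union_left _ hb₀) b' hb' hne.symm
    obtain ⟨r, hr⟩ : ∃ r, finrank F (b₀.1 ⊔ b'.1 : Submodule F V) = k + r :=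
      ⟨_, (Nat.add_sub_cancel' (by omega)).symm⟩
    refine le_trans ?_ (pow_mul_card_smul_eq_le (s := n - k - r) (by omega) b₀ b' b c hr)
    rw [← hq]
    exact Nat.mul_le_mul_right _ (hpow (Nat.mul_le_mul (by omega) (by omega)))
  have hlt : #(N₁ ∪ N₂) ^ 2 * q ^ (t * (k + t + 1) * (t + 1)) <
      q ^ ((t + 1) * (n - k - 8 * t)) := by
    refine (Nat.mul_le_mul_right _ (Nat.pow_le_pow_left hNcard 2)).trans_lt ?_
    rw [← pow_mul, ← pow_add]
    refine Nat.pow_lt_pow_right (by omega) ?_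
    obtain ⟨s, hs⟩ : ∃ s, n = k + 8 * t + s := ⟨n - k - 8 * t, by omega⟩
    rw [show n - k - 8 * t = s by omega]
    have h1 : 998 * k * t ≤ s := by nlinarith
    have h2 : 2 * k * t + 100 * t * t < s := by nlinarith
    have h3 : t * (k + t + 1) ≤ 2 * k * t := by nlinarith
    calc 48 * t ^ 2 * 2 + t * (k + t + 1) * (t + 1)
        ≤ 96 * t * t * (t + 1) + 2 * k * t * (t + 1) :=
          Nat.add_le_add (by nlinarith) (Nat.mul_le_mul_right _ h3)
      _ = (96 * t * t + 2 * k * t) * (t + 1) := by ring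
      _ < (t + 1) * s := by
          rw [mul_comm (t + 1)]
          exact Nat.mul_lt_mul_of_pos_right (by nlinarith) (by omega)
  obtain ⟨P, Q, -, hPQ, hdeg⟩ := exists_simple_signed_sum (G := V ≃ₗ[F] V) subspaceInc_smul
    N₁ N₂ hd hN b₀ hb₀ _ hκ _ hlt _ le_rfl γ hL
  refine ⟨P, Q, ⟨U, hU⟩, M.toNat, by omega, hPQ.trans ?_, fun T => ?_⟩
  · rw [← hq]
    refine (Nat.mul_le_mul_left _ hNcard).trans ?_
    rw [← pow_add]
    refine hpow ?_
    have h1 : 48 * t ^ 2 ≤ 2 * k * t * (t + 1) := by nlinarith [Nat.mul_le_mul_right t hk.le]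
    have h3 : t * (k + t + 1) ≤ 2 * k * t := by nlinarith
    calc _ ≤ 2 * k * t * (t + 1) + 2 * k * t * (t + 1) :=
          Nat.add_le_add (Nat.mul_le_mul_right _ h3) h1
      _ = _ := by ring
  · rw [hdeg T, hγ T]
    congr 1
    simp only [Subtype.ext_iff]
    split_ifs
    · rw [mul_one, Int.toNat_of_nonneg hM.le]
    · rw [mul_zero]

theorem exists_small_design {t k n : ℕ} (ht : 0 < t) (hk : 12 * (t + 1) < k)
    (hn : 1000 * k * t ≤ n) (hV : finrank F V = n) :
    ∃ (lam : ℕ) (S : Finset (Subspaces F V k)), 0 < lam ∧ (∃ U, U ∉ S) ∧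
      #S ≤ Nat.card F ^ (12 * (t + 1) * n) ∧ ∀ T, incidenceDeg (subspaceInc t k) S T = lam := by
  classical
  have := Module.finite_of_finite F (M := V)
  have : Finite (V ≃ₗ[F] V) := Finite.of_injective _ DFunLike.coe_injective
  have : Finite (Submodule F V) := Finite.of_injective _ SetLike.coe_injective
  have := Fintype.ofFinite (V ≃ₗ[F] V)
  have := Fintype.ofFinite (Subspaces F V k)
  have := Fintype.ofFinite (Subspaces F V t)
  have hkt : 1000 * k ≤ n := by nlinarith
  obtain ⟨P, Q, u, m, hm, hcard, hdeg⟩ := exists_switch (F := F) (V := V) ht hk hn hV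
  have hA := card_subspaces_le_pow (F := F) (V := V) t
  have hB := pow_le_card_subspaces (F := F) (V := V) (k := k) (by omega)
  obtain ⟨q, hq⟩ : ∃ q, q = Nat.card F := ⟨_, rfl⟩
  have hq2 : 2 ≤ q := hq ▸ Finite.one_lt_card
  rw [← hq, hV, Nat.card_eq_fintype_card] at hA hB
  rw [← hq] at hcard ⊢
  have hpow : ∀ {a b : ℕ}, a ≤ b → q ^ a ≤ q ^ b := fun h => Nat.pow_le_pow_right (by omega) h
  set Λ := q ^ (4 * k * t * (t + 1)) with hΛ
  have hkt2 : k * t * (t + 1) * 50 ≤ n * (t + 1) := by nlinarith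
  have hkt3 : 12 * (k * t * (t + 1)) ≤ k * n := by nlinarith
  have hsize : 2 * Fintype.card (Subspaces F V t) ^ 6 * Λ ^ 10 ≤
      Fintype.card (Subspaces F V k) := by
    refine le_trans ?_ hB
    calc 2 * Fintype.card (Subspaces F V t) ^ 6 * Λ ^ 10
        ≤ q * (q ^ (t * n)) ^ 6 * Λ ^ 10 :=
          Nat.mul_le_mul_right _ (Nat.mul_le_mul hq2 (Nat.pow_le_pow_left hA 6))
      _ = q ^ (1 + t * n * 6 + 4 * k * t * (t + 1) * 10) := by
          rw [hΛ, pow_add, pow_add, pow_one, pow_mul q (t * n), pow_mul q (4 * k * t * (t + 1))]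
      _ ≤ q ^ (k * (n - k)) := by
          refine hpow ?_
          obtain ⟨s, hs⟩ : ∃ s, n = k + s := ⟨n - k, by omega⟩
          rw [show n - k = s by omega]
          have h1 : 999 * n ≤ 1000 * s := by omega
          have h2 : (12 * t + 13) * s ≤ k * s := Nat.mul_le_mul_right _ (by omega)
          nlinarith
  have h12 : 12 ≤ Λ := by
    have h1 : 4 ≤ 4 * k * t * (t + 1) := by nlinarith [Nat.mul_pos (show 0 < k by omega) ht]
    calc 12 ≤ 2 ^ 4 := by norm_num
      _ ≤ q ^ 4 := Nat.pow_le_pow_left hq2 4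
      _ ≤ _ := hpow h1
  obtain ⟨lam, hlam, S, hS, hSdeg⟩ := exists_design_of_switch (G := V ≃ₗ[F] V)
    subspaceInc_smul P Q u m hm hdeg Λ h12 hcard hsize
  refine ⟨lam, S, hlam, ?_, hS.trans ?_, hSdeg⟩
  · by_contra! hall
    rw [card_eq_iff_eq_univ S |>.2 (eq_univ_iff_forall.2 hall)] at hS
    have hu : 0 < Fintype.card (Subspaces F V t) := Fintype.card_pos_iff.2 ⟨u⟩
    have hx : 0 < Fintype.card (Subspaces F V t) ^ 3 * Λ ^ 5 := by positivity
    have : 2 * (Fintype.card (Subspaces F V t) ^ 3 * Λ ^ 5) ^ 2 ≤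
        Fintype.card (Subspaces F V t) ^ 3 * Λ ^ 5 := by
      refine le_trans (le_of_eq ?_) (hsize.trans hS)
      ring
    nlinarith
  · calc Fintype.card (Subspaces F V t) ^ 3 * Λ ^ 5 ≤ (q ^ (t * n)) ^ 3 * Λ ^ 5 :=
          Nat.mul_le_mul_right _ (Nat.pow_le_pow_left hA 3)
      _ = q ^ (t * n * 3 + 4 * k * t * (t + 1) * 5) := by
          rw [hΛ, pow_add, pow_mul q (t * n), pow_mul q (4 * k * t * (t + 1))]
      _ ≤ _ := hpow (by nlinarith)

end Assembly

end Design

/-- main theorem, a q-analog of Teirlinck's theorem.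
There exists an absolute constant `c > 0` such that for every prime power `q`
(realized as the cardinality of a finite field `F`), every positive integer `t`,
every integer `k > 12(t+1)`, and every `n ≥ c·k·t`, there exist a positive integer `λ`
and a simple nontrivial `t`-`(n,k,λ)` design over `F_q` with at most `q^{12(t+1)n}`
blocks.  Here the design is a finset `B` of `k`-dimensional subspaces of `F_q^n`
(simplicity is automatic since a finset has no repeated elements), every
`t`-dimensional subspace lies in exactly `λ` blocks, and nontriviality means that
some `k`-dimensional subspace is not a block. -/
theorem exists_simple_nontrivial_design :
    ∃ c : ℝ, 0 < c ∧
      ∀ (F : Type) [Field F] [Fintype F] (t k n : ℕ),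
        0 < t → 12 * (t + 1) < k → c * k * t ≤ n →
          ∃ (lam : ℕ) (B : Finset (Submodule F (Fin n → F))),
            0 < lam ∧
            (∀ b ∈ B, finrank F b = k) ∧
            (∀ V : Submodule F (Fin n → F), finrank F V = t →
              Nat.card {b : Submodule F (Fin n → F) // b ∈ B ∧ V ≤ b} = lam) ∧
            (∃ U : Submodule F (Fin n → F), finrank F U = k ∧ U ∉ B) ∧
            B.card ≤ (Fintype.card F) ^ (12 * (t + 1) * n) := by
  refine ⟨1000, by norm_num, fun F _ _ t k n ht hk hn => ?_⟩
  classical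
  have hn' : 1000 * k * t ≤ n := by exact_mod_cast hn
  obtain ⟨lam, S, hlam, ⟨U, hU⟩, hS, hdeg⟩ :=
    exists_small_design (F := F) (V := Fin n → F) ht hk hn' (Module.finrank_fin_fun F)
  refine ⟨lam, S.map ⟨Subtype.val, Subtype.val_injective⟩, hlam, fun b hb => ?_, fun V hV => ?_,
    ⟨U.1, U.2, fun h => ?_⟩, ?_⟩
  · obtain ⟨b, -, rfl⟩ := Finset.mem_map.1 hb
    exact b.2
  · have h := hdeg ⟨V, hV⟩
    unfold incidenceDeg incidenceInd at h
    rw [Finset.sum_boole, Nat.cast_inj] at h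
    rw [← h, ← Finset.card_map ⟨Subtype.val, Subtype.val_injective⟩, ← Fintype.card_coe,
      ← Nat.card_eq_fintype_card]
    refine Nat.card_congr (Equiv.subtypeEquivRight fun b => ?_)
    simp only [Finset.mem_map, Finset.mem_filter, Function.Embedding.coeFn_mk]
    constructor
    · rintro ⟨⟨b, hb, rfl⟩, hVb⟩
      exact ⟨b, ⟨hb, hVb⟩, rfl⟩
    · rintro ⟨b, ⟨hb, hVb⟩, rfl⟩
      exact ⟨⟨b, hb, rfl⟩, hVb⟩
  · obtain ⟨b, hb, hbU⟩ := Finset.mem_map.1 h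
    exact hU (Subtype.ext hbU ▸ hb)
  · rwa [Finset.card_map, ← Nat.card_eq_fintype_card]
end

section
/- Let q be a prime power, let 1 ≤ t ≤ k, and let V be a t-dimensional subspace of F_q^{k+t}. Then there exist integers f₀, f₁, …, f_t and a positive integer m, with m ≤ q^{k(t+1)²} and |f_j| ≤ q^{k(t+1)²} for all j, such that for every t-dimensional subspace V′ of F_q^{k+t}, the sum of f_{dim(U ∩ V)} over all k-dimensional subspaces U of F_q^{k+t} with V′ ⊆ U equals m if V′ = V and equals 0 otherwise. -/
open Module
open scoped Classical

section Flags

variable {F E E' : Type*} [Field F] [AddCommGroup E] [Module F E]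
  [AddCommGroup E'] [Module F E']

lemma map_eq_of_linearEquiv_extending {p : Submodule F E} {p' : Submodule F E'}
    {e₀ : p ≃ₗ[F] p'} {e : E ≃ₗ[F] E'} (h : ∀ x : p, e x = e₀ x) :
    p.map (e : E →ₗ[F] E') = p' := by
  ext y
  constructor
  · rintro ⟨x, hx, rfl⟩
    have := h ⟨x, hx⟩
    simp only [LinearEquiv.coe_coe] at this ⊢
    rw [this]
    exact (e₀ ⟨x, hx⟩).2
  · intro hy
    refine ⟨e₀.symm ⟨y, hy⟩, (e₀.symm ⟨y, hy⟩).2, ?_⟩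
    simp [h]

variable [FiniteDimensional F E] [FiniteDimensional F E']

/-- An isomorphism between subspaces of spaces of equal dimension extends to the whole spaces. -/
lemma exists_linearEquiv_extending (h : finrank F E = finrank F E') {p : Submodule F E}
    {p' : Submodule F E'} (e₀ : p ≃ₗ[F] p') :
    ∃ e : E ≃ₗ[F] E', ∀ x : p, e x = e₀ x := by
  obtain ⟨c, hc⟩ := p.exists_isCompl
  obtain ⟨c', hc'⟩ := p'.exists_isCompl
  have h1 := Submodule.finrank_add_eq_of_isCompl hc
  have h2 := Submodule.finrank_add_eq_of_isCompl hc'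
  have h3 := e₀.finrank_eq
  let ec : c ≃ₗ[F] c' := LinearEquiv.ofFinrankEq _ _ (by omega)
  refine ⟨(Submodule.prodEquivOfIsCompl p c hc).symm ≪≫ₗ (e₀.prodCongr ec) ≪≫ₗ
    Submodule.prodEquivOfIsCompl p' c' hc', fun x => ?_⟩
  simp

/-- The general linear group acts transitively on two-step flags of given dimensions. -/
lemma exists_linearEquiv_map_flag {p P p' P' : Submodule F E} (hp : p ≤ P) (hp' : p' ≤ P')
    (h : finrank F p = finrank F p') (H : finrank F P = finrank F P') :
    ∃ e : E ≃ₗ[F] E, p.map (e : E →ₗ[F] E) = p' ∧ P.map (e : E →ₗ[F] E) = P' := by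
  let e₀ : p ≃ₗ[F] p' := LinearEquiv.ofFinrankEq _ _ h
  obtain ⟨e₁, he₁⟩ := exists_linearEquiv_extending H
    (Submodule.submoduleOfEquivOfLe hp ≪≫ₗ e₀ ≪≫ₗ (Submodule.submoduleOfEquivOfLe hp').symm)
  obtain ⟨e, he⟩ := exists_linearEquiv_extending rfl e₁
  refine ⟨e, ?_, map_eq_of_linearEquiv_extending he⟩
  refine map_eq_of_linearEquiv_extending (e₀ := e₀) fun x => ?_
  have h1 := he ⟨x, hp x.2⟩
  have h2 := he₁ ⟨⟨x, hp x.2⟩, x.2⟩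
  simp only at h1 h2
  rw [h1, h2]
  rfl

lemma finrank_inf_sup_add {U V V' : Submodule F E} (h : V' ≤ U) :
    finrank F ↥(U ⊓ (V ⊔ V')) + finrank F ↥(V' ⊓ V) = finrank F ↥(U ⊓ V) + finrank F V' := by
  have h1 := Submodule.finrank_sup_add_finrank_inf_eq (U ⊓ V) V'
  rwa [inf_sup_assoc_of_le V h, show U ⊓ V ⊓ V' = V' ⊓ V by
    rw [inf_assoc, inf_eq_right.2 (inf_le_right.trans h), inf_comm]] at h1

/-- The number of `k`-dimensional subspaces containing `V'` and meeting `V` in dimension `j`. -/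
noncomputable def superspaceCount (V V' : Submodule F E) (k j : ℕ) : ℕ :=
  {U : Submodule F E | (V' ≤ U ∧ finrank F U = k) ∧ finrank F ↥(U ⊓ V) = j}.ncard

lemma superspaceCount_congr {V V₁ V₂ : Submodule F E} (h : finrank F V₁ = finrank F V₂)
    (H : finrank F ↥(V₁ ⊓ V) = finrank F ↥(V₂ ⊓ V)) (k j : ℕ) :
    superspaceCount V V₁ k j = superspaceCount V V₂ k j := by
  have h1 := Submodule.finrank_sup_add_finrank_inf_eq V V₁
  have h2 := Submodule.finrank_sup_add_finrank_inf_eq V V₂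
  rw [inf_comm] at h1 h2
  obtain ⟨e, he, hE⟩ := exists_linearEquiv_map_flag (le_sup_right : V₁ ≤ V ⊔ V₁)
    (le_sup_right : V₂ ≤ V ⊔ V₂) h (by omega)
  have key : ∀ U : Submodule F E, V₁ ≤ U →
      finrank F ↥(U.map (e : E →ₗ[F] E) ⊓ V) = finrank F ↥(U ⊓ V) := by
    intro U hU
    have hU' : V₂ ≤ U.map (e : E →ₗ[F] E) := he ▸ Submodule.map_mono hU
    have k1 := finrank_inf_sup_add (V := V) hU
    have k2 := finrank_inf_sup_add (V := V) hU'
    rw [← hE, ← Submodule.map_inf _ e.injective, LinearEquiv.finrank_map_eq] at k2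
    omega
  refine Set.ncard_congr (fun U _ => U.map (e : E →ₗ[F] E)) ?_ ?_ ?_
  · rintro U ⟨⟨hU, hk⟩, hj⟩
    exact ⟨⟨he ▸ Submodule.map_mono hU, by rw [LinearEquiv.finrank_map_eq, hk]⟩,
      by rw [key U hU, hj]⟩
  · intro U W _ _ hUW
    exact Submodule.map_injective_of_injective e.injective hUW
  · rintro W ⟨⟨hW, hk⟩, hj⟩
    obtain ⟨U, rfl⟩ : ∃ U : Submodule F E, U.map (e : E →ₗ[F] E) = W :=
      ⟨W.comap (e : E →ₗ[F] E), Submodule.map_comap_eq_of_surjective e.surjective W⟩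
    have hU : V₁ ≤ U := by
      rw [← he] at hW
      exact (Submodule.map_le_map_iff_of_injective e.injective _ _).1 hW
    rw [key U hU] at hj
    rw [LinearEquiv.finrank_map_eq] at hk
    exact ⟨U, ⟨⟨hU, hk⟩, hj⟩, rfl⟩

lemma superspaceCount_eq_zero {V V' : Submodule F E} {k j : ℕ}
    (h : j < finrank F ↥(V' ⊓ V)) : superspaceCount V V' k j = 0 := by
  rw [superspaceCount, Set.eq_empty_of_forall_notMem (s := {U : Submodule F E | _}),
    Set.ncard_empty]
  rintro U ⟨⟨hU, -⟩, hj⟩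
  have := Submodule.finrank_mono (inf_le_inf_right V hU)
  omega

lemma exists_superspace_inf_eq {V V' : Submodule F E} {d : ℕ}
    (h : finrank F V + finrank F V' + d ≤ finrank F E + finrank F ↥(V' ⊓ V)) :
    ∃ U : Submodule F E, V' ≤ U ∧ finrank F U = finrank F V' + d ∧ U ⊓ V = V' ⊓ V := by
  obtain ⟨C, hC⟩ := (V ⊔ V').exists_isCompl
  have h1 := Submodule.finrank_add_eq_of_isCompl hC
  have h2 := Submodule.finrank_sup_add_finrank_inf_eq V V'
  rw [inf_comm] at h2
  obtain ⟨v, hv⟩ := exists_linearIndependent_of_le_finrank (R := F) (M := C) (n := d) (by omega)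
  obtain ⟨D, hDC, hD⟩ : ∃ D ≤ C, finrank F D = d :=
    ⟨(Submodule.span F (Set.range v)).map C.subtype, Submodule.map_subtype_le _ _, by
      rw [Submodule.finrank_map_subtype_eq, finrank_span_eq_card hv, Fintype.card_fin]⟩
  have hd : Disjoint (V ⊔ V') D := hC.disjoint.mono_right hDC
  refine ⟨V' ⊔ D, le_sup_left, ?_, ?_⟩
  · have h3 := Submodule.finrank_sup_add_finrank_inf_eq V' D
    rw [(hd.mono_left le_sup_right).eq_bot, finrank_bot] at h3
    omega
  · refine le_antisymm (le_inf ?_ inf_le_right) (inf_le_inf_right V le_sup_left)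
    calc (V' ⊔ D) ⊓ V ≤ (V' ⊔ D) ⊓ (V ⊔ V') := inf_le_inf_left _ le_sup_left
      _ = V' ⊔ D ⊓ (V ⊔ V') := sup_inf_assoc_of_le D le_sup_right
      _ = V' := by rw [inf_comm, hd.eq_bot, sup_bot_eq]

end Flags

section Counting

variable {F E : Type*} [Field F] [Fintype F] [AddCommGroup E] [Module F E]
  [FiniteDimensional F E]

lemma finite_submodule_of_finite_field : Finite (Submodule F E) :=
  have : Finite E := Module.finite_of_finite F
  inferInstance

lemma ncard_superspaces_le {V' : Submodule F E} {k t : ℕ}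
    (hE : finrank F E = k + t) (hV' : finrank F V' = t) :
    {U : Submodule F E | V' ≤ U ∧ finrank F U = k}.ncard ≤ Fintype.card F ^ (k * t) := by
  have hQ : finrank F (E ⧸ V') = k := by
    have := Submodule.finrank_quotient_add_finrank V'
    omega
  have hcard : Nat.card ((E ⧸ V') →ₗ[F] (Fin t → F)) = Fintype.card F ^ (k * t) := by
    rw [Module.natCard_eq_pow_finrank (K := F), Module.finrank_linearMap, hQ,
      Module.finrank_fin_fun, Nat.card_eq_fintype_card]
  have : Finite ((E ⧸ V') →ₗ[F] (Fin t → F)) := Module.finite_of_finite F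
  rw [← hcard, ← Set.ncard_univ]
  refine (Set.ncard_le_ncard (t := (fun φ : (E ⧸ V') →ₗ[F] (Fin t → F) =>
    LinearMap.ker (φ ∘ₗ V'.mkQ)) '' Set.univ) ?_ (Set.toFinite _)).trans
    (Set.ncard_image_le (Set.toFinite _))
  rintro U ⟨hU, hk⟩
  have h1 := Submodule.finrank_quotient_add_finrank U
  let e : (E ⧸ U) ≃ₗ[F] (Fin t → F) :=
    LinearEquiv.ofFinrankEq _ _ (by rw [Module.finrank_fin_fun]; omega)
  refine ⟨V'.liftQ ((e : (E ⧸ U) →ₗ[F] (Fin t → F)) ∘ₗ U.mkQ) ?_, trivial, ?_⟩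
  · rwa [LinearEquiv.ker_comp, Submodule.ker_mkQ]
  · simp only [Submodule.liftQ_mkQ]
    rw [LinearEquiv.ker_comp, Submodule.ker_mkQ]

lemma superspaceCount_le {V V' : Submodule F E} {k t : ℕ}
    (hE : finrank F E = k + t) (hV' : finrank F V' = t) (j : ℕ) :
    superspaceCount V V' k j ≤ Fintype.card F ^ (k * t) :=
  have := finite_submodule_of_finite_field (F := F) (E := E)
  (Set.ncard_le_ncard (fun _ h => h.1) (Set.toFinite _)).trans (ncard_superspaces_le hE hV')

lemma superspaceCount_pos {V V' : Submodule F E} {k t : ℕ} (htk : t ≤ k)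
    (hE : finrank F E = k + t) (hV : finrank F V = t) (hV' : finrank F V' = t) :
    0 < superspaceCount V V' k (finrank F ↥(V' ⊓ V)) := by
  have := finite_submodule_of_finite_field (F := F) (E := E)
  obtain ⟨U, h1, h2, h3⟩ := exists_superspace_inf_eq (V := V) (V' := V') (d := k - t) (by omega)
  exact (Set.ncard_pos (Set.toFinite _)).2 ⟨U, ⟨h1, by omega⟩, by rw [h3]⟩

lemma finsum_superspaces {V V' : Submodule F E} {t : ℕ} (hV : finrank F V = t)
    (k : ℕ) (f : ℕ → ℤ) :
    (∑ᶠ U ∈ {U : Submodule F E | V' ≤ U ∧ finrank F U = k}, f (finrank F ↥(U ⊓ V))) =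
      ∑ j : Fin (t + 1), (superspaceCount V V' k j : ℤ) * f j := by
  have := finite_submodule_of_finite_field (F := F) (E := E)
  have : Fintype (Submodule F E) := Fintype.ofFinite _
  rw [finsum_mem_eq_finite_toFinset_sum _ (Set.toFinite _),
    ← Finset.sum_fiberwise_of_maps_to (t := Finset.range (t + 1))
      (g := fun U : Submodule F E => finrank F ↥(U ⊓ V)),
    Fin.sum_univ_eq_sum_range (fun j => (superspaceCount V V' k j : ℤ) * f j)]
  · refine Finset.sum_congr rfl fun j _ => ?_
    rw [Finset.sum_congr rfl (g := fun _ => f j)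
      (fun U hU => by rw [(Finset.mem_filter.1 hU).2]), Finset.sum_const, nsmul_eq_mul,
      superspaceCount, ← Set.ncard_coe_finset]
    congr 3
    ext U
    simp
  · intro U _
    have := Submodule.finrank_mono (inf_le_right : U ⊓ V ≤ V)
    simp only [Finset.mem_range]
    omega

end Counting

lemma factorial_mul_pow_le {q t k : ℕ} (hq : 2 ≤ q) (htk : t ≤ k) :
    (t + 1).factorial * (q ^ (k * t)) ^ (t + 1) ≤ q ^ (k * (t + 1) ^ 2) := by
  have h1 : t + 1 ≤ q ^ k := calc
    t + 1 ≤ 2 ^ t := Nat.lt_two_pow_self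
    _ ≤ q ^ t := Nat.pow_le_pow_left hq t
    _ ≤ q ^ k := Nat.pow_le_pow_right (by omega) htk
  calc (t + 1).factorial * (q ^ (k * t)) ^ (t + 1)
      ≤ (q ^ k) ^ (t + 1) * (q ^ (k * t)) ^ (t + 1) :=
        Nat.mul_le_mul_right _ ((Nat.factorial_le_pow _).trans (Nat.pow_le_pow_left h1 _))
    _ = q ^ (k * (t + 1) ^ 2) := by
        rw [← pow_mul, ← pow_mul, ← pow_add]; congr 1; ring

/-- local decodability, concrete form.
Let `q` be a prime power (realized as the cardinality of a finite field `F`), let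
`1 ≤ t ≤ k`, and let `V` be a `t`-dimensional subspace of `F_q^{k+t}`.  Then there
exist integers `f 0, f 1, …, f t` and a positive integer `m`, with `m ≤ q^{k(t+1)²}`
and `|f j| ≤ q^{k(t+1)²}` for all `j ≤ t`, such that for every `t`-dimensional
subspace `V′` of `F_q^{k+t}`, the sum of `f (dim (U ∩ V))` over all `k`-dimensional
subspaces `U` of `F_q^{k+t}` with `V′ ⊆ U` equals `m` if `V′ = V` and `0` otherwise. -/
theorem local_decodability (F : Type) [Field F] [Fintype F] (q t k : ℕ)
    (hq : q = Fintype.card F) (ht : 1 ≤ t) (htk : t ≤ k)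
    (V : Submodule F (Fin (k + t) → F)) (hV : finrank F V = t) :
    ∃ (f : ℕ → ℤ) (m : ℕ),
      0 < m ∧ (m : ℤ) ≤ (q : ℤ) ^ (k * (t + 1) ^ 2) ∧
      (∀ j ≤ t, |f j| ≤ (q : ℤ) ^ (k * (t + 1) ^ 2)) ∧
      ∀ V' : Submodule F (Fin (k + t) → F), finrank F V' = t →
        (∑ᶠ U ∈ {U : Submodule F (Fin (k + t) → F) | V' ≤ U ∧ finrank F U = k},
            f (finrank F ↥(U ⊓ V))) = if V' = V then (m : ℤ) else 0 := by
  have hE : finrank F (Fin (k + t) → F) = k + t := Module.finrank_fin_fun F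
  have hq2 : 2 ≤ q := hq ▸ Fintype.one_lt_card
  -- Rows of the incidence matrix with no representative `V'` are filled from the identity.
  obtain ⟨A, hcount, hzero, hdiag, hle⟩ : ∃ A : Matrix (Fin (t + 1)) (Fin (t + 1)) ℤ,
      (∀ V' : Submodule F (Fin (k + t) → F), finrank F V' = t →
        ∀ i : Fin (t + 1), finrank F ↥(V' ⊓ V) = i →
        ∀ j, A i j = superspaceCount V V' k j) ∧
      (∀ i j, j < i → A i j = 0) ∧ (∀ i, 0 < A i i) ∧
      ∀ i j, |A i j| ≤ (q : ℤ) ^ (k * t) := by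
    have hrow : ∀ i : Fin (t + 1), ∃ r : Fin (t + 1) → ℤ,
        (∀ V' : Submodule F (Fin (k + t) → F), finrank F V' = t →
          finrank F ↥(V' ⊓ V) = i → ∀ j, r j = superspaceCount V V' k j) ∧
        (∀ j, j < i → r j = 0) ∧ 0 < r i ∧ ∀ j, |r j| ≤ (q : ℤ) ^ (k * t) := by
      intro i
      by_cases h : ∃ W : Submodule F (Fin (k + t) → F), finrank F W = t ∧
          finrank F ↥(W ⊓ V) = i
      · obtain ⟨W, hW, hi⟩ := h
        refine ⟨fun j => superspaceCount V W k j, fun V' hV' hi' j => ?_, fun j hj => ?_, ?_,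
          fun j => ?_⟩
        · simp only
          rw [superspaceCount_congr (hW.trans hV'.symm) (hi.trans hi'.symm)]
        · simp only
          rw [superspaceCount_eq_zero (by rw [hi]; exact hj), Nat.cast_zero]
        · have := superspaceCount_pos htk hE hV hW
          rw [hi] at this
          exact Int.natCast_pos.2 this
        · rw [Nat.abs_cast, hq]
          exact_mod_cast superspaceCount_le hE hW j
      · refine ⟨Pi.single i 1, fun V' hV' hi' => absurd ⟨V', hV', hi'⟩ h,
          fun j hj => Pi.single_eq_of_ne hj.ne 1, by simp, fun j => ?_⟩
        have h1 : (1 : ℤ) ≤ (q : ℤ) ^ (k * t) := one_le_pow₀ (by omega)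
        by_cases hj : j = i
        · subst hj; simpa using h1
        · rw [Pi.single_eq_of_ne hj]; simp
    choose A h1 h2 h3 h4 using hrow
    exact ⟨A, fun V' hV' i => h1 i V' hV', h2, h3, h4⟩
  have hdet : 0 < A.det := by
    rw [Matrix.det_of_isUpperTriangular (fun i j h => hzero i j h)]
    exact Finset.prod_pos fun i _ => hdiag i
  have hbound : ∀ B : Matrix (Fin (t + 1)) (Fin (t + 1)) ℤ,
      (∀ i j, |B i j| ≤ (q : ℤ) ^ (k * t)) → |B.det| ≤ (q : ℤ) ^ (k * (t + 1) ^ 2) := by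
    intro B hB
    have h1 := Matrix.det_le (abv := AbsoluteValue.abs) (A := B) hB
    rw [Fintype.card_fin, nsmul_eq_mul] at h1
    exact h1.trans (by exact_mod_cast factorial_mul_pow_le hq2 htk)
  obtain ⟨f, hf⟩ : ∃ f : ℕ → ℤ, ∀ j : Fin (t + 1), f j = A.adjugate j (Fin.last t) :=
    ⟨fun j => A.adjugate (Fin.ofNat (t + 1) j) (Fin.last t), fun j => by
      simp only [Fin.ofNat_eq_cast, Fin.cast_val_eq_self]⟩
  refine ⟨f, A.det.toNat, by omega, ?_, fun j hj => ?_, fun V' hV' => ?_⟩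
  · rw [Int.toNat_of_nonneg hdet.le]
    exact (le_abs_self _).trans (hbound A hle)
  · rw [hf ⟨j, by omega⟩, Matrix.adjugate_apply]
    refine hbound _ fun a b => ?_
    have h1 : (1 : ℤ) ≤ (q : ℤ) ^ (k * t) := one_le_pow₀ (by omega)
    rw [Matrix.updateRow_apply]
    split_ifs
    · rw [Pi.single_apply]
      split_ifs
      · simpa using h1
      · rw [abs_zero]; omega
    · exact hle a b
  · have hi : finrank F ↥(V' ⊓ V) < t + 1 := by
      have := Submodule.finrank_mono (inf_le_right : V' ⊓ V ≤ V)
      omega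
    rw [finsum_superspaces hV, Int.toNat_of_nonneg hdet.le]
    have h1 := congrFun (congrFun A.mul_adjugate ⟨_, hi⟩) (Fin.last t)
    rw [Matrix.mul_apply] at h1
    have hiff : (⟨finrank F ↥(V' ⊓ V), hi⟩ : Fin (t + 1)) = Fin.last t ↔ V' = V := by
      rw [Fin.ext_iff, Fin.val_last]
      constructor
      · intro h
        have h2 := Submodule.eq_of_le_of_finrank_eq (inf_le_left : V' ⊓ V ≤ V') (h.trans hV'.symm)
        have h3 := Submodule.eq_of_le_of_finrank_eq (inf_le_right : V' ⊓ V ≤ V) (h.trans hV.symm)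
        exact h2.symm.trans h3
      · rintro rfl
        change finrank F ↥(V' ⊓ V') = t
        rw [inf_idem, hV']
    calc _ = ∑ j, A ⟨_, hi⟩ j * A.adjugate j (Fin.last t) := by
          refine Finset.sum_congr rfl fun j _ => ?_
          rw [hcount V' hV' ⟨_, hi⟩ rfl j, hf]
      _ = _ := by
          rw [h1, Matrix.smul_apply, Matrix.one_apply]
          simp only [hiff]
          split_ifs <;> simp
end
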